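/- Let d ∈ {1, 2, 3, 7, 11, 19, 43, 67, 163}, let K = ℚ(√−d) with ring of integers O_K, and let ε be a generator of the (finite cyclic) unit group O_K^×. Then there is no Galois extension L/K whose Galois group is isomorphic to the symmetric group S₃ ≅ GL₂(F₂), such that L/K is unramified at every prime ideal of O_K not dividing 2 and L contains a square root of ε. -/

import Mathlib

open NumberField


theorem quad_repr {F : Type*} [Field F] [CharZero F] [Algebra ℚ F] (D : ℤ) (hD : ∀ q : ℚ, q ^ 2 ≠ D)
    (r : F) (hr : r ^ 2 = (D : F)) (hF : Module.finrank ℚ F = 2) (z : F) :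
    ∃ a b : ℚ, z = (a : F) + b * r := by
  have hli : LinearIndependent ℚ ![(1 : F), r] := by
    rw [LinearIndependent.pair_iff]
    intro a b hab
    simp only [Algebra.smul_def, mul_one, eq_ratCast] at hab
    have hb : b = 0 := by
      by_contra hb
      apply hD (a / b)
      have h1 : (b : F) ≠ 0 := by exact_mod_cast hb
      have h2 : r = -((a : F) / b) := by field_simp; linear_combination hab
      have h3 : ((a / b : ℚ) : F) ^ 2 = ((D : ℚ) : F) := by
        push_cast
        rw [← hr, h2]; ring
      exact_mod_cast h3
    subst hb
    simp at hab
    exact ⟨hab, rfl⟩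
  have : FiniteDimensional ℚ F := Module.finite_of_finrank_pos (by omega)
  let b := basisOfLinearIndependentOfCardEqFinrank hli (by simp [hF])
  refine ⟨b.repr z 0, b.repr z 1, ?_⟩
  have := b.sum_repr z
  simp [b, Algebra.smul_def, Fin.sum_univ_two] at this
  simpa [b] using this.symm

theorem quad_unique {F : Type*} [Field F] [CharZero F] (D : ℤ) (hD : ∀ q : ℚ, q ^ 2 ≠ D)
    (r : F) (hr : r ^ 2 = (D : F)) {a b a' b' : ℚ} (h : (a : F) + b * r = a' + b' * r) :
    a = a' ∧ b = b' := by
  have hb : b = b' := by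
    by_contra hb
    apply hD ((a' - a) / (b - b'))
    have h1 : ((b : F) - b') ≠ 0 := by rw [sub_ne_zero]; exact_mod_cast hb
    have h2 : r = ((a' : F) - a) / (b - b') := by field_simp; linear_combination h
    have h3 : (((a' - a) / (b - b') : ℚ) : F) ^ 2 = ((D : ℚ) : F) := by
      push_cast
      rw [← hr, h2]
    exact_mod_cast h3
  subst hb
  exact ⟨by simpa using h, rfl⟩

theorem exists_conj {F Ω : Type*} [Field F] [Field Ω] [Algebra F Ω] [Normal F Ω] 
    (c : F) (hc : ∀ q : F, q ^ 2 ≠ c) (r : Ω) (hr : r ^ 2 = algebraMap F Ω c) :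
    ∃ σ : Ω ≃ₐ[F] Ω, σ r = -r := by
  have hmon : (Polynomial.X ^ 2 - Polynomial.C c : Polynomial F).Monic :=
    Polynomial.monic_X_pow_sub_C c two_ne_zero
  have hirr : Irreducible (Polynomial.X ^ 2 - Polynomial.C c : Polynomial F) := by
    apply X_pow_sub_C_irreducible_of_prime Nat.prime_two hc
  have hmin : minpoly F r = Polynomial.X ^ 2 - Polynomial.C c :=
    (minpoly.eq_of_irreducible_of_monic hirr (by simp [hr]) hmon).symm
  refine minpoly.exists_algEquiv_of_root' (Algebra.IsAlgebraic.isAlgebraic r) ?_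
  rw [hmin]; simp [hr]

theorem int_of_isIntegral_rat {F : Type*} [Field F] [CharZero F] (a : ℚ) (h : IsIntegral ℤ (a : F)) :
    ∃ n : ℤ, (n : ℚ) = a := by
  have h2 : IsIntegral ℤ a := by
    have : IsIntegral ℤ (algebraMap ℚ F a) := by simpa using h
    exact (isIntegral_algebraMap_iff (algebraMap ℚ F).injective).mp this
  obtain ⟨n, hn⟩ := IsIntegrallyClosed.isIntegral_iff.mp h2
  exact ⟨n, by simpa using hn⟩

theorem quad_integral2 {F : Type*} [Field F] [CharZero F] (D : ℤ) (hsq : Squarefree D)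
    (r : F) (hr : r ^ 2 = (D : F)) (a b : ℚ)
    (h1 : IsIntegral ℤ ((a : F) + b * r)) (h2 : IsIntegral ℤ ((a : F) - b * r)) :
    ∃ A B C : ℤ, 2 * a = A ∧ 2 * b = B ∧ A ^ 2 - D * B ^ 2 = 4 * C := by
  obtain ⟨A, hA⟩ := int_of_isIntegral_rat (F := F) (2 * a) (by
    have e : ((2 * a : ℚ) : F) = ((a : F) + b * r) + ((a : F) - b * r) := by push_cast; ring
    rw [e]; exact h1.add h2)
  obtain ⟨C, hC⟩ := int_of_isIntegral_rat (F := F) (a ^ 2 - D * b ^ 2) (by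
    have e : ((a ^ 2 - D * b ^ 2 : ℚ) : F) = ((a : F) + b * r) * ((a : F) - b * r) := by
      push_cast; rw [← hr]; ring
    rw [e]; exact h1.mul h2)
  have hE : (D : ℚ) * (2 * b) ^ 2 = ((A ^ 2 - 4 * C : ℤ) : ℚ) := by
    push_cast; rw [hA, hC]; ring
  have hD0 : D ≠ 0 := hsq.ne_zero
  obtain ⟨B, hB⟩ : ∃ B : ℤ, (B : ℚ) = 2 * b := by
    have hDQ : (D : ℚ) ≠ 0 := by exact_mod_cast hD0
    -- the square is an integer, hence so is the base
    have h3 : ((D : ℚ) * (2 * b)) ^ 2 = ((D * (A ^ 2 - 4 * C) : ℤ) : ℚ) := by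
      push_cast at hE ⊢; rw [← hE]; ring
    have h4 : IsIntegral ℤ ((D : ℚ) * (2 * b)) := by
      apply IsIntegral.of_pow (n := 2) (by norm_num)
      rw [h3]; exact isIntegral_algebraMap (R := ℤ) (A := ℚ)
    obtain ⟨n, hn⟩ := IsIntegrallyClosed.isIntegral_iff.mp h4
    simp at hn
    have h5 : n ^ 2 = D * (A ^ 2 - 4 * C) := by
      have : ((n ^ 2 : ℤ) : ℚ) = ((D * (A ^ 2 - 4 * C) : ℤ) : ℚ) := by
        rw [← h3, ← hn]; push_cast; ring
      exact_mod_cast this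
    have h6 : D ∣ n := by
      have := (hsq.dvd_pow_iff_dvd (n := 2) (y := n) (by norm_num)).mp ⟨_, h5⟩
      exact this
    obtain ⟨B, rfl⟩ := h6
    refine ⟨B, ?_⟩
    push_cast at hn
    exact mul_left_cancel₀ hDQ hn
  refine ⟨A, B, C, hA.symm, hB.symm, ?_⟩
  have : ((A ^ 2 - D * B ^ 2 : ℤ) : ℚ) = ((4 * C : ℤ) : ℚ) := by
    push_cast; rw [hA, hB, hC]; ring
  exact_mod_cast this

theorem quad_integral {F : Type*} [Field F] [CharZero F] (D : ℤ) (hsq : Squarefree D)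
    (h4 : D % 4 = 2 ∨ D % 4 = 3)
    (r : F) (hr : r ^ 2 = (D : F)) (a b : ℚ)
    (h1 : IsIntegral ℤ ((a : F) + b * r)) (h2 : IsIntegral ℤ ((a : F) - b * r)) :
    ∃ A B : ℤ, a = A ∧ b = B := by
  obtain ⟨A, B, C, hA, hB, hC⟩ := quad_integral2 D hsq r hr a b h1 h2
  have hAB : 2 ∣ A ∧ 2 ∣ B := by
    have hA4 : A % 4 = 0 ∨ A % 4 = 1 ∨ A % 4 = 2 ∨ A % 4 = 3 := by omega
    have hB4 : B % 4 = 0 ∨ B % 4 = 1 ∨ B % 4 = 2 ∨ B % 4 = 3 := by omega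
    have h := congrArg (· % 4) hC
    rcases hA4 with h1 | h1 | h1 | h1 <;> rcases hB4 with h2 | h2 | h2 | h2 <;>
      rcases h4 with h3 | h3 <;>
      simp [pow_two, Int.sub_emod, Int.mul_emod, h1, h2, h3] at h <;> omega
  obtain ⟨⟨A', rfl⟩, ⟨B', rfl⟩⟩ := hAB
  refine ⟨A', B', ?_, ?_⟩
  · push_cast at hA; linarith
  · push_cast at hB; linarith


theorem quad_discr (k : Type*) [Field k] [NumberField k] (D : ℤ) (hD : ∀ q : ℚ, q ^ 2 ≠ D)
    (r : 𝓞 k) (hr : r ^ 2 = (D : 𝓞 k))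
    (h_integral : ∀ z : 𝓞 k, ∃ a b : ℤ, z = (a : 𝓞 k) + b * r) :
    discr k = 4 * D := by
  have hli : LinearIndependent ℤ ![(1 : 𝓞 k), r] := by
    rw [LinearIndependent.pair_iff]
    intro a b hab
    have h : (((a : ℚ) : k)) + ((b : ℚ) : k) * (r : k) = ((0 : ℚ) : k) + ((0 : ℚ) : k) * (r : k) := by
      have := congrArg (algebraMap (𝓞 k) k) hab
      simpa [zsmul_eq_mul] using this
    have := quad_unique D hD (r : k) (by simpa using congrArg (algebraMap (𝓞 k) k) hr) h
    exact_mod_cast this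
  have hsp : ⊤ ≤ Submodule.span ℤ (Set.range ![(1 : 𝓞 k), r]) := by
    intro z _
    obtain ⟨a, b, rfl⟩ := h_integral z
    rw [Matrix.range_cons, Matrix.range_cons, Matrix.range_empty, Set.union_empty,
      Set.singleton_union, Submodule.mem_span_pair]
    exact ⟨a, b, by simp [zsmul_eq_mul]⟩
  let B := Module.Basis.mk hli hsp
  have hB0 : B 0 = 1 := by simp [B]
  have hB1 : B 1 = r := by simp [B]
  have hrep : ∀ a b : ℤ, B.repr ((a : 𝓞 k) + b * r) = Finsupp.single 0 a + Finsupp.single 1 b := by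
    intro a b
    have : ((a : 𝓞 k) + b * r) = a • B 0 + b • B 1 := by rw [hB0, hB1]; simp [zsmul_eq_mul]
    rw [this, map_add, map_smul, map_smul, B.repr_self, B.repr_self, Finsupp.smul_single,
      Finsupp.smul_single]; simp
  have htr : ∀ a b : ℤ, Algebra.trace ℤ (𝓞 k) ((a : 𝓞 k) + b * r) = 2 * a := by
    intro a b
    rw [Algebra.trace_eq_matrix_trace B, Matrix.trace, Fin.sum_univ_two]
    simp only [Matrix.diag, Algebra.leftMulMatrix_eq_repr_mul, hB0, hB1]
    have e : ((a : 𝓞 k) + b * r) * r = ((b * D : ℤ) : 𝓞 k) + a * r := by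
      push_cast; rw [← hr]; ring
    rw [mul_one, e, hrep, hrep]
    simp; ring
  have t1 := htr 1 0
  have t2 := htr 0 1
  have t3 := htr D 0
  simp only [Int.cast_one, Int.cast_zero, zero_mul, add_zero, one_mul, zero_add, mul_zero] at t1 t2 t3
  rw [← discr_eq_discr k B, Algebra.discr_def, Matrix.det_fin_two]
  simp only [Algebra.traceMatrix_apply, Algebra.traceForm_apply, hB0, hB1, one_mul, mul_one,
    ← pow_two, hr, t2, t3]
  rw [one_pow, t1]
  ring

open NumberField.mixedEmbedding MeasureTheory InfinitePlace in
theorem mink_cube (k : Type*) [Field k] [NumberField k] (h2 : Module.finrank ℚ k = 2)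
    (β : 𝓞 k) (hβ : β ≠ 0) (I : Ideal (𝓞 k)) (hI : I ^ 3 = Ideal.span {β}) (c : ℝ) (hc : 0 < c)
    (hcond : 4 * ((2 : ℝ)⁻¹ ^ nrComplexPlaces k * Real.sqrt |(discr k : ℝ)|) <
      2 ^ nrRealPlaces k * Real.pi ^ nrComplexPlaces k * c ^ 2) :
    ∃ γ ∈ I, γ ≠ 0 ∧ ∀ w : InfinitePlace k, (w γ) ^ 3 < c ^ 3 * w β := by
  classical
  have hI0 : I ≠ ⊥ := by
    rintro rfl
    apply hβ
    rw [← Ideal.zero_eq_bot, zero_pow three_ne_zero, Ideal.zero_eq_bot, eq_comm] at hI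
    exact Ideal.span_singleton_eq_bot.mp hI
  have hβk : (β : k) ≠ 0 := by exact_mod_cast hβ
  let J : (FractionalIdeal (nonZeroDivisors (𝓞 k)) k)ˣ :=
    FractionalIdeal.mk0 k ⟨I, mem_nonZeroDivisors_iff_ne_zero.mpr hI0⟩
  let f : InfinitePlace k → NNReal := fun w => ⟨c * (w (β : k)) ^ (1 / 3 : ℝ), by positivity⟩
  have hf : ∀ w, (f w : ℝ) ^ 3 = c ^ 3 * w (β : k) := by
    intro w
    change (c * (w (β : k)) ^ (1 / 3 : ℝ)) ^ 3 = _
    rw [mul_pow, ← Real.rpow_natCast ((w (β : k)) ^ (1 / 3 : ℝ)), ← Real.rpow_mul (by positivity)]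
    norm_num
  have hnorm : ((Ideal.absNorm I : ℕ) : ℝ) ^ 3 = |((Algebra.norm ℚ (β : k) : ℚ) : ℝ)| := by
    have := congrArg Ideal.absNorm hI
    rw [map_pow, Ideal.absNorm_span_singleton] at this
    rw [← Nat.cast_pow, this, Nat.cast_natAbs, ← Algebra.coe_norm_int]
    simp
  have hprod : ∏ w, (f w : ℝ) ^ (mult w) = c ^ 2 * (Ideal.absNorm I : ℕ) := by
    rw [← pow_left_inj₀ (n := 3) (by positivity) (by positivity) (by norm_num), mul_pow, hnorm,
      ← Finset.prod_pow]
    have e : ∀ w : InfinitePlace k, ((f w : ℝ) ^ (mult w)) ^ 3 =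
        (c ^ 3) ^ (mult w) * (w (β : k)) ^ (mult w) := by
      intro w
      rw [← mul_pow, ← hf w]; ring
    rw [Finset.prod_congr rfl (fun w _ => e w), Finset.prod_mul_distrib,
      prod_eq_abs_norm, Finset.prod_pow_eq_pow_sum, sum_mult_eq, h2]
    push_cast
    ring
  have hvol : minkowskiBound k J < volume (convexBodyLT k f) := by
    rw [convexBodyLT_volume, minkowskiBound, volume_fundamentalDomain_fractionalIdealLatticeBasis,
      volume_fundamentalDomain_latticeBasis, mixedEmbedding.finrank, h2]
    have hN : 0 < ((Ideal.absNorm I : ℕ) : ℝ) := by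
      have : Ideal.absNorm I ≠ 0 := by rwa [Ne, Ideal.absNorm_eq_zero_iff]
      positivity
    have hL : ENNReal.ofReal ((FractionalIdeal.absNorm (J : FractionalIdeal (nonZeroDivisors (𝓞 k)) k) : ℚ) : ℝ) *
        ((2 : ENNReal)⁻¹ ^ nrComplexPlaces k * (NNReal.sqrt ‖discr k‖₊ : NNReal)) * 2 ^ 2 =
        ENNReal.ofReal ((Ideal.absNorm I : ℕ) *
          ((2 : ℝ)⁻¹ ^ nrComplexPlaces k * Real.sqrt |(discr k : ℝ)|) * 2 ^ 2) := by
      rw [ENNReal.ofReal_mul (by positivity), ENNReal.ofReal_mul (by positivity),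
        ENNReal.ofReal_mul (by positivity), ENNReal.ofReal_pow (by positivity),
        ENNReal.ofReal_pow (by positivity), ENNReal.ofReal_inv_of_pos (by norm_num)]
      have e1 : ((FractionalIdeal.absNorm (J : FractionalIdeal (nonZeroDivisors (𝓞 k)) k) : ℚ) : ℝ) =
          (Ideal.absNorm I : ℕ) := by
        simp [J, FractionalIdeal.coeIdeal_absNorm]
      have e2 : ((NNReal.sqrt ‖discr k‖₊ : NNReal) : ENNReal) =
          ENNReal.ofReal (Real.sqrt |(discr k : ℝ)|) := by
        rw [← ENNReal.ofReal_coe_nnreal, Real.coe_sqrt, coe_nnnorm, Int.norm_eq_abs]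
      rw [e1, e2]
      simp
    have hR : ((convexBodyLTFactor k : NNReal) : ENNReal) * ∏ w, (f w : ENNReal) ^ (mult w) =
        ENNReal.ofReal ((2 ^ nrRealPlaces k * Real.pi ^ nrComplexPlaces k) *
          (c ^ 2 * (Ideal.absNorm I : ℕ))) := by
      rw [← hprod, ENNReal.ofReal_mul (by positivity),
        ENNReal.ofReal_prod_of_nonneg (fun w _ => by positivity)]
      congr 1
      · rw [← ENNReal.ofReal_coe_nnreal]
        simp [convexBodyLTFactor]
      · refine Finset.prod_congr rfl fun w _ => ?_
        rw [ENNReal.ofReal_pow (by positivity), ENNReal.ofReal_coe_nnreal]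
    rw [hL, ENNReal.ofNNReal_finsetProd, Finset.prod_congr rfl (fun w _ => ENNReal.coe_pow (f w) (mult w)), hR, ENNReal.ofReal_lt_ofReal_iff (by positivity)]
    nlinarith
  obtain ⟨a, ha, ha0, haw⟩ := exists_ne_zero_mem_ideal_lt k J hvol
  rw [FractionalIdeal.coe_mk0, FractionalIdeal.mem_coeIdeal] at ha
  obtain ⟨γ, hγ, rfl⟩ := ha
  refine ⟨γ, hγ, by rintro rfl; simp at ha0, fun w => ?_⟩
  rw [← hf w]
  exact pow_lt_pow_left₀ (haw w) (by positivity) (by norm_num)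


theorem arith3 (D X Y a b g h : ℤ) (hD : 3 ∣ D) (hb : 3 ∣ b) (ha : ¬ 3 ∣ a)
    (e1 : X * a + D * Y * b = g ^ 3 + 3 * g * h ^ 2 * D)
    (e2 : X * b + Y * a = 3 * g ^ 2 * h + h ^ 3 * D) :
    3 ∣ Y ∧ (3 ∣ X → 27 ∣ X) := by
  have p3 : Prime (3 : ℤ) := Int.prime_three
  obtain ⟨D', rfl⟩ := hD
  obtain ⟨b', rfl⟩ := hb
  have hY : 3 ∣ Y := by
    have : 3 ∣ Y * a := ⟨g ^ 2 * h + h ^ 3 * D' - X * b', by linear_combination e2⟩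
    exact (p3.dvd_or_dvd this).resolve_right ha
  refine ⟨hY, fun hX => ?_⟩
  obtain ⟨Y', rfl⟩ := hY
  obtain ⟨X', hX'⟩ := hX
  have hg : 3 ∣ g := by
    apply p3.dvd_of_dvd_pow (n := 3)
    exact ⟨X' * a + 9 * D' * Y' * b' - 3 * g * h ^ 2 * D', by rw [hX'] at e1; linear_combination -e1⟩
  obtain ⟨g', rfl⟩ := hg
  have h27 : 27 ∣ X * a := ⟨g' ^ 3 + g' * h ^ 2 * D' - D' * Y' * b', by linear_combination e1⟩
  have hcop : IsCoprime (27 : ℤ) a := by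
    have : IsCoprime (3 : ℤ) a := (Prime.coprime_iff_not_dvd p3).mpr ha
    have := this.pow_left (m := 3)
    norm_num at this; exact this
  exact hcop.dvd_of_dvd_mul_right h27

theorem search_imag (D : ℤ) (hD : D ∈ ({-6, -21, -33, -57, -129, -201, -489} : Finset ℤ))
    (X Y n : ℤ) (h : X ^ 2 - D * Y ^ 2 = n ^ 3) (hn : 9 * n ^ 2 < 16 * (-D)) (hY : 3 ∣ Y) : Y = 0 := by
  obtain ⟨y, rfl⟩ := hY
  by_contra hy
  have hy0 : y ≠ 0 := by rintro rfl; simp at hy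
  have hy1 : 1 ≤ y ^ 2 := by have := sq_nonneg y; have : y ^ 2 ≠ 0 := by positivity
                             omega
  have hX := sq_nonneg X
  have hD6 : 6 ≤ -D := by simp at hD; omega
  have hn0 : 0 < n := by
    by_contra hn0
    have : n ^ 3 ≤ 0 := by
      have := Odd.pow_nonpos (n := 3) (by decide) (not_lt.mp hn0); exact this
    nlinarith
  -- bounds
  have hle : n ≤ 29 := by
    have : -D ≤ 489 := by simp at hD; omega
    nlinarith
  have hy3 : y ^ 2 ≤ 5 := by
    simp only [Finset.mem_insert, Finset.mem_singleton] at hD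
    have h3 : 9 * (-D) * y ^ 2 ≤ n * n ^ 2 := by nlinarith
    have h4 : 9 * (9 * (-D) * y ^ 2) ≤ n * (16 * (-D)) := by nlinarith
    have h5 : (81 * y ^ 2 - n * 16) * (-D) ≤ 0 := by nlinarith
    have h6 : 81 * y ^ 2 - n * 16 ≤ 0 := by
      by_contra h; push Not at h; nlinarith
    omega
  have hyy : y ^ 2 = 1 ∨ y ^ 2 = 4 := by
    have : y ≤ 2 := by nlinarith
    have : -2 ≤ y := by nlinarith
    interval_cases y <;> simp at *
  have key : IsSquare (n ^ 3 + 9 * D * y ^ 2) := ⟨X, by linear_combination -h⟩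
  have hnn : 0 ≤ n ^ 3 + 9 * D * y ^ 2 := by nlinarith
  clear h hX hy hy0 hy1 hD6 hy3
  simp only [Finset.mem_insert, Finset.mem_singleton] at hD
  rcases hyy with e | e <;> rw [e] at key hnn <;>
  rcases hD with rfl | rfl | rfl | rfl | rfl | rfl | rfl <;>
  interval_cases n <;> first | omega | (norm_num at key)

theorem search_real3 (X Y n : ℤ) (h : X ^ 2 - 3 * Y ^ 2 = n ^ 3) (hb : X ^ 2 + 3 * Y ^ 2 < 43)
    (hY : 3 ∣ Y) (hX : 3 ∣ X → 27 ∣ X) : Y = 0 ∨ (X = 0 ∧ (Y = 3 ∨ Y = -3)) := by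
  have : Y ≤ 3 := by nlinarith
  have : -3 ≤ Y := by nlinarith
  have : X ≤ 6 := by nlinarith
  have : -6 ≤ X := by nlinarith
  have hn1 : n ≤ 4 := by by_contra hc; have : 5 ≤ n := by omega
                         nlinarith [pow_le_pow_left₀ (by norm_num) this 3]
  have hn2 : -4 ≤ n := by by_contra hc; have : 5 ≤ -n := by omega
                          nlinarith [pow_le_pow_left₀ (by norm_num) this 3]
  obtain ⟨y, rfl⟩ := hY
  have : y ≤ 1 := by omega
  have : -1 ≤ y := by omega
  interval_cases y
  · right
    interval_cases X <;> interval_cases n <;> first | omega | simp_all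
  · left; rfl
  · right
    interval_cases X <;> interval_cases n <;> first | omega | simp_all

theorem search_real6 (X Y n : ℤ) (h : X ^ 2 - 6 * Y ^ 2 = n ^ 3) (hb : X ^ 2 + 6 * Y ^ 2 < 120)
    (hY : 3 ∣ Y) : Y = 0 := by
  obtain ⟨y, rfl⟩ := hY
  have : y ≤ 1 := by nlinarith
  have : -1 ≤ y := by nlinarith
  by_contra hy
  have hyy : y = 1 ∨ y = -1 := by omega
  have hy2 : (3 * y) ^ 2 = 9 := by rcases hyy with rfl | rfl <;> norm_num
  rw [hy2] at h hb
  have : X ≤ 8 := by nlinarith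
  have : -8 ≤ X := by nlinarith
  have hn1 : n ≤ 4 := by by_contra hc; have : 5 ≤ n := by omega
                         nlinarith [pow_le_pow_left₀ (by norm_num) this 3]
  have hn2 : -4 ≤ n := by by_contra hc; have : 5 ≤ -n := by omega
                          nlinarith [pow_le_pow_left₀ (by norm_num) this 3]
  interval_cases X <;> interval_cases n <;> omega


theorem cube_ideal {R : Type*} [CommRing R] [IsDedekindDomain R] (σ : R ≃+* R)
    (hσ : ∀ q : Ideal R, q.IsPrime → q ≠ ⊥ → (2 : R) ∈ q → Ideal.map σ q = q)
    (β m : R) (hβ : β ≠ 0) (hm : β * σ β = m ^ 3)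
    (hq : ∀ q : Ideal R, q.IsPrime → q ≠ ⊥ → (2 : R) ∉ q →
      ∃ u v β' : R, u ≠ 0 ∧ v ≠ 0 ∧ β' ∉ q ∧ β * u ^ 3 = β' * v ^ 3) :
    ∃ I : Ideal R, I ^ 3 = Ideal.span {β} := by
  classical
  have hmul : ∀ (q : Ideal R) (x y : R), x ≠ 0 → y ≠ 0 →
      (UniqueFactorizationMonoid.normalizedFactors (Ideal.span {x * y})).count q =
      (UniqueFactorizationMonoid.normalizedFactors (Ideal.span {x})).count q +
      (UniqueFactorizationMonoid.normalizedFactors (Ideal.span {y})).count q := by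
    intro q x y hx hy
    rw [← Ideal.span_singleton_mul_span_singleton,
      UniqueFactorizationMonoid.normalizedFactors_mul (by simpa using hx) (by simpa using hy),
      Multiset.count_add]
  have hpow : ∀ (q : Ideal R) (x : R),
      (UniqueFactorizationMonoid.normalizedFactors (Ideal.span {x ^ 3})).count q =
      3 * (UniqueFactorizationMonoid.normalizedFactors (Ideal.span {x})).count q := by
    intro q x
    rw [← Ideal.span_singleton_pow, UniqueFactorizationMonoid.normalizedFactors_pow,
      Multiset.count_nsmul]
  have hcount : ∀ q ∈ UniqueFactorizationMonoid.normalizedFactors (Ideal.span {β}),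
      3 ∣ (UniqueFactorizationMonoid.normalizedFactors (Ideal.span {β})).count q := by
    intro q hqm
    have hqp := UniqueFactorizationMonoid.prime_of_normalized_factor q hqm
    have hqprime : q.IsPrime := Ideal.isPrime_of_prime hqp
    have hq0 : q ≠ ⊥ := hqp.ne_zero
    by_cases h2 : (2 : R) ∈ q
    · have hmap := hσ q hqprime hq0 h2
      have hσβ : σ β ≠ 0 := by simpa using hβ
      have hm0 : m ≠ 0 := by
        rintro rfl
        have : β * σ β = 0 := by rw [hm]; ring
        exact (mul_ne_zero hβ hσβ) this
      have key : (UniqueFactorizationMonoid.normalizedFactors (Ideal.span {σ β})).count q =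
          (UniqueFactorizationMonoid.normalizedFactors (Ideal.span {β})).count q := by
        have h1 := UniqueFactorizationMonoid.emultiplicity_eq_count_normalizedFactors
          hqp.irreducible (b := Ideal.span {β}) (by simpa using hβ)
        have h2 := UniqueFactorizationMonoid.emultiplicity_eq_count_normalizedFactors
          hqp.irreducible (b := Ideal.span {σ β}) (by simpa using hσβ)
        rw [normalize_eq] at h1 h2
        have h3 : emultiplicity q (Ideal.span {β}) = emultiplicity q (Ideal.span {σ β}) := by
          rw [emultiplicity_eq_emultiplicity_iff]
          intro n
          rw [Ideal.dvd_span_singleton, Ideal.dvd_span_singleton]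
          have h4 : Ideal.map σ (q ^ n) = q ^ n := by
            rw [Ideal.map_pow, hmap]
          constructor
          · intro h
            rw [← h4]; exact Ideal.mem_map_of_mem _ h
          · intro h
            rw [← h4] at h
            obtain ⟨x, hx, hxe⟩ := (Ideal.mem_map_iff_of_surjective σ σ.surjective).mp h
            rwa [← σ.injective hxe]
        rw [h1, h2] at h3
        exact_mod_cast h3.symm
      have h5 := hmul q β (σ β) hβ hσβ
      rw [hm, hpow, key] at h5
      omega
    · obtain ⟨u, v, β', hu, hv, hb, he⟩ := hq q hqprime hq0 h2
      have hb0 : β' ≠ 0 := by rintro rfl; exact hb q.zero_mem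
      have h5 := hmul q β (u ^ 3) hβ (pow_ne_zero _ hu)
      rw [he, hmul q β' (v ^ 3) hb0 (pow_ne_zero _ hv), hpow, hpow] at h5
      have h6 : (UniqueFactorizationMonoid.normalizedFactors (Ideal.span {β'})).count q = 0 := by
        rw [Multiset.count_eq_zero]
        intro hmem
        exact hb (Ideal.dvd_span_singleton.mp (UniqueFactorizationMonoid.dvd_of_mem_normalizedFactors hmem))
      omega
  obtain ⟨t, ht⟩ := Multiset.exists_smul_of_dvd_count _ hcount
  refine ⟨t.prod, ?_⟩
  rw [← Multiset.prod_nsmul, ← ht]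
  exact Ideal.prod_normalizedFactors_eq_self (by simpa using hβ)


theorem emb_sq {k : Type*} [Field k] (r : k) (D : ℤ) (hr : r ^ 2 = (D : k)) (φ : k →+* ℂ) :
    (φ r).re ^ 2 - (φ r).im ^ 2 = D ∧ ((φ r).re = 0 ∨ (φ r).im = 0) := by
  have h : (φ r) * (φ r) = (D : ℂ) := by rw [← pow_two, ← map_pow, hr]; simp
  have h1 := congrArg Complex.re h
  have h2 := congrArg Complex.im h
  simp only [Complex.mul_re, Complex.mul_im, Complex.intCast_re, Complex.intCast_im] at h1 h2
  refine ⟨by rw [← h1]; ring, ?_⟩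
  have : (φ r).re * (φ r).im = 0 := by linarith
  exact mul_eq_zero.mp this

theorem emb_norm {k : Type*} [Field k] (r : k) (X Y : ℤ) (φ : k →+* ℂ) :
    ‖φ (X + Y * r)‖ ^ 2 = (X + Y * (φ r).re) ^ 2 + (Y * (φ r).im) ^ 2 := by
  rw [Complex.sq_norm, Complex.normSq_apply]
  simp
  ring

set_option maxHeartbeats 800000 in
open NumberField.InfinitePlace in
theorem quad_small (k : Type*) [Field k] [NumberField k] (h2 : Module.finrank ℚ k = 2)
    (D : ℤ) (hD : ∀ q : ℚ, q ^ 2 ≠ D)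
    (r : 𝓞 k) (hr : r ^ 2 = (D : 𝓞 k))
    (h_integral : ∀ z : 𝓞 k, ∃ a b : ℤ, z = (a : 𝓞 k) + b * r)
    (σ : k ≃ₐ[ℚ] k) (hσ : σ r = -r) (β : 𝓞 k) (hβ : β ≠ 0) 
    (I : Ideal (𝓞 k)) (hI : I ^ 3 = Ideal.span {β}) (c : ℝ) (hc : 0 < c)
    (hc2 : if D < 0 then 9 * c ^ 4 = 16 * |(D : ℝ)| else 4 * |(D : ℝ)| < c ^ 4) :
    ∃ γ ξ : 𝓞 k, γ ≠ 0 ∧ γ ^ 3 = ξ * β ∧ ∀ X Y : ℤ, ξ = X + Y * r → 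
      (X : ℝ) ^ 2 + |(D : ℝ)| * Y ^ 2 < c ^ 6 := by
  have hrk : (r : k) ^ 2 = (D : k) := by simpa using congrArg (algebraMap (𝓞 k) k) hr
  have hdisc := quad_discr k D hD r hr h_integral
  have hsig := card_add_two_mul_card_eq_rank k
  rw [h2] at hsig
  have hD0 : (D : ℝ) ≠ 0 := by
    intro h
    have : D = 0 := by exact_mod_cast h
    exact hD 0 (by simp [this])
  have hsq : Real.sqrt |(discr k : ℝ)| = 2 * Real.sqrt |(D : ℝ)| := by
    rw [hdisc]; push_cast
    rw [abs_mul, Real.sqrt_mul (by positivity)]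
    congr 1
    rw [abs_of_pos (by norm_num), show (4 : ℝ) = 2 ^ 2 by norm_num]
    exact Real.sqrt_sq (by norm_num)
  have hsD : 0 < Real.sqrt |(D : ℝ)| := Real.sqrt_pos.mpr (abs_pos.mpr hD0)
  have hsD2 : Real.sqrt |(D : ℝ)| ^ 2 = |(D : ℝ)| := Real.sq_sqrt (abs_nonneg _)
  have hcond : 4 * ((2 : ℝ)⁻¹ ^ nrComplexPlaces k * Real.sqrt |(discr k : ℝ)|) <
      2 ^ nrRealPlaces k * Real.pi ^ nrComplexPlaces k * c ^ 2 := by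
    rw [hsq]
    set S := Real.sqrt |(D : ℝ)|
    have hpi := Real.pi_gt_three
    rcases (show (nrRealPlaces k = 2 ∧ nrComplexPlaces k = 0) ∨
      (nrRealPlaces k = 0 ∧ nrComplexPlaces k = 1) by omega) with ⟨h1, h0⟩ | ⟨h1, h0⟩
    · rw [h1, h0]
      by_cases hneg : D < 0
      · exfalso
        have hpos : 0 < nrRealPlaces k := by omega
        classical
        unfold nrRealPlaces at hpos
        replace hpos := Fintype.card_pos_iff.mp hpos
        obtain ⟨w, hw⟩ := hpos
        have hreal := (isReal_iff.mp hw)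
        obtain ⟨e1, e2⟩ := emb_sq (r : k) D hrk w.embedding
        have e3 : (w.embedding (r : k)).im = 0 := by
          have := RingHom.congr_fun (ComplexEmbedding.isReal_iff.mp hreal) (r : k)
          rw [ComplexEmbedding.conjugate_coe_eq] at this
          exact Complex.conj_eq_iff_im.mp this
        rw [e3] at e1
        have : (D : ℝ) < 0 := by exact_mod_cast hneg
        nlinarith [sq_nonneg (w.embedding (r : k)).re]
      · rw [if_neg hneg] at hc2
        have : 2 * S < c ^ 2 := by
          by_contra hcon
          push Not at hcon
          nlinarith [sq_nonneg c]
        norm_num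
        linarith
    · rw [h1, h0]
      have : 4 * S ≤ 3 * c ^ 2 := by
        by_contra hcon
        push Not at hcon
        split_ifs at hc2 <;> nlinarith [sq_nonneg c]
      norm_num
      nlinarith [sq_nonneg c, pow_pos hc 2]
  obtain ⟨γ, hγI, hγ0, hw⟩ := mink_cube k h2 β hβ I hI c hc hcond
  have hmem : γ ^ 3 ∈ Ideal.span {β} := by
    rw [← hI]; exact Ideal.pow_mem_pow hγI 3
  obtain ⟨ξ, hξ⟩ := Ideal.mem_span_singleton'.mp hmem
  refine ⟨γ, ξ, hγ0, hξ.symm, ?_⟩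
  have hwx : ∀ φ : k →+* ℂ, ‖φ (ξ : k)‖ ^ 2 < c ^ 6 := by
    intro φ
    have h := hw (mk φ)
    rw [InfinitePlace.apply, InfinitePlace.apply] at h
    have e : ‖φ (γ : k)‖ ^ 3 = ‖φ (ξ : k)‖ * ‖φ (β : k)‖ := by
      rw [← norm_pow, ← norm_mul, ← map_pow, ← map_mul]
      congr 2
      have := congrArg (algebraMap (𝓞 k) k) hξ
      simpa using this.symm
    have hb : 0 < ‖φ (β : k)‖ := by
      rw [norm_pos_iff]
      intro h0
      rw [map_eq_zero] at h0
      exact hβ (by exact_mod_cast h0)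
    rw [e] at h
    have h3 : ‖φ (ξ : k)‖ < c ^ 3 := lt_of_mul_lt_mul_right h hb.le
    calc ‖φ (ξ : k)‖ ^ 2 < (c ^ 3) ^ 2 := by gcongr
      _ = c ^ 6 := by ring
  intro X Y hXY
  obtain ⟨φ⟩ : Nonempty (k →+* ℂ) := inferInstance
  have hξk : (ξ : k) = X + Y * (r : k) := by rw [hXY]; simp
  have b1 := hwx φ
  have b2 := hwx (φ.comp (σ : k →+* k))
  rw [hξk, emb_norm] at b1 b2
  have hσr : (φ.comp (σ : k →+* k)) (r : k) = - φ (r : k) := by simp [hσ]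
  rw [hσr, Complex.neg_re, Complex.neg_im] at b2
  obtain ⟨e1, e2⟩ := emb_sq (r : k) D hrk φ
  have e3 : |(D : ℝ)| = (φ (r : k)).re ^ 2 + (φ (r : k)).im ^ 2 := by
    rw [← e1]
    rcases e2 with h | h <;> rw [h] <;> simp
  rw [e3]
  nlinarith


theorem squarefree_small (n : ℕ) (hn : 0 < n ∧ n < 529)
    (h : ∀ x ∈ Finset.range 23, x * x ∣ n → x = 1) : Squarefree n := by
  intro x hx
  have h1 := Nat.le_of_dvd hn.1 hx
  have : x < 23 := by nlinarith
  rw [Nat.isUnit_iff]; exact  (h x (Finset.mem_range.mpr this) hx)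

theorem D_facts (D : ℤ) (hD : D ∈ ({3, 6, -1, -6, -21, -33, -57, -129, -201, -489} : Finset ℤ)) :
    Squarefree D ∧ (D % 4 = 2 ∨ D % 4 = 3) := by
  simp only [Finset.mem_insert, Finset.mem_singleton] at hD
  rw [← Int.squarefree_natAbs]
  rcases hD with rfl|rfl|rfl|rfl|rfl|rfl|rfl|rfl|rfl|rfl <;>
    refine ⟨?_, by decide⟩ <;> apply squarefree_small <;> decide

theorem nonsq_of_squarefree (D : ℤ) (h : Squarefree D) (h1 : D ≠ 1) (q : ℚ) : q ^ 2 ≠ D := by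
  intro hq
  obtain ⟨n, hn⟩ := int_of_isIntegral_rat (F := ℚ) q (by
    apply IsIntegral.of_pow (n := 2) (by norm_num)
    simp only [Rat.cast_id, hq]
    exact isIntegral_algebraMap (R := ℤ) (A := ℚ))
  rw [← hn] at hq
  have hq' : n * n = D := by rw [← pow_two]; exact_mod_cast hq
  have := h n ⟨1, by rw [hq', mul_one]⟩
  rcases Int.isUnit_iff.mp this with h | h <;> subst h <;> simp at hq' <;> omega

theorem xi_cube (k : Type*) [Field k] [CharZero k] (D : ℤ)
    (hD : D ∈ ({3, 6, -1, -6, -21, -33, -57, -129, -201, -489} : Finset ℤ))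
    (r : k) (hr : r ^ 2 = (D : k)) (X Y n : ℤ) (hn : X ^ 2 - D * Y ^ 2 = n ^ 3) (hn0 : n ≠ 0)
    (h3 : 3 ∣ D → 3 ∣ Y ∧ (3 ∣ X → 27 ∣ X))
    (hneg : D < 0 → 9 * n ^ 2 < 16 * (-D))
    (hp3 : D = 3 → X ^ 2 + 3 * Y ^ 2 < 43) (hp6 : D = 6 → X ^ 2 + 6 * Y ^ 2 < 120) :
    ∃ e : k, (X : k) + Y * r = e ^ 3 := by
  have hY0 : Y = 0 → ∃ e : k, (X : k) + Y * r = e ^ 3 := by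
    rintro rfl
    have hnk : (n : k) ≠ 0 := by exact_mod_cast hn0
    have hx : (X : k) ^ 2 = n ^ 3 := by 
      have : X ^ 2 = n ^ 3 := by linarith
      exact_mod_cast this
    refine ⟨X / n, ?_⟩
    rw [div_pow, ← hx]
    have : (X : k) ≠ 0 := by
      intro h; rw [h] at hx
      exact hnk (pow_eq_zero_iff (three_ne_zero) |>.mp (by rw [← hx]; ring))
    field_simp
    simp
  by_cases hm1 : D = -1
  · subst hm1
    have h := hneg (by norm_num)
    have hn1 : n ≤ 1 := by nlinarith
    have hn2 : -1 ≤ n := by nlinarith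
    have hn3 : n = 1 := by
      rcases (show n = 1 ∨ n = -1 by omega) with h | h
      · exact h
      · subst h; nlinarith
    subst hn3
    have hx : X ^ 2 + Y ^ 2 = 1 := by linarith
    by_cases hY : Y = 0
    · exact hY0 hY
    · have : 1 ≤ Y ^ 2 := by have := sq_nonneg Y; have : Y ^ 2 ≠ 0 := by positivity
                             omega
      have hX : X = 0 := by
        have : X ^ 2 = 0 := by nlinarith [sq_nonneg X]
        exact pow_eq_zero_iff two_ne_zero |>.mp this
      subst hX
      refine ⟨-Y * r, ?_⟩
      have hy : (Y : k) ^ 2 = 1 := by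
        have : Y ^ 2 = 1 := by linarith
        exact_mod_cast this
      push_cast at hr ⊢
      linear_combination (-(Y : k) * r) * hy * 1 + (Y : k) ^ 3 * r * hr
  have h3D : 3 ∣ D := by
    simp only [Finset.mem_insert, Finset.mem_singleton] at hD
    omega
  obtain ⟨h3Y, h3X⟩ := h3 h3D
  by_cases hd3 : D = 3
  · subst hd3
    rcases search_real3 X Y n (by linarith) (hp3 rfl) h3Y h3X with h | ⟨h0, h⟩
    · exact hY0 h
    · subst h0
      push_cast at hr
      rcases h with h | h <;> subst h
      · exact ⟨r, by push_cast; linear_combination -r * hr⟩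
      · exact ⟨-r, by push_cast; linear_combination r * hr⟩
  by_cases hd6 : D = 6
  · subst hd6
    exact hY0 (search_real6 X Y n (by linarith) (hp6 rfl) h3Y)
  · have hmem : D ∈ ({-6, -21, -33, -57, -129, -201, -489} : Finset ℤ) := by
      simp only [Finset.mem_insert, Finset.mem_singleton] at hD ⊢
      omega
    have hlt : D < 0 := by
      simp only [Finset.mem_insert, Finset.mem_singleton] at hmem
      omega
    exact hY0 (search_imag D hmem X Y n hn (hneg hlt) h3Y)

theorem key_lemma (k : Type*) [Field k] [NumberField k] (h2 : Module.finrank ℚ k = 2)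
    (D : ℤ) (hD : D ∈ ({3, 6, -1, -6, -21, -33, -57, -129, -201, -489} : Finset ℤ))
    (r : k) (hr : r ^ 2 = (D : k)) (B : Set (𝓞 k)) (h0 : 0 ∉ B)
    (hcube : ∀ β ∈ B, ∀ β' ∈ B, ∃ c : k, (β' : k) = β * c ^ 3)
    (hprime : ∀ q : Ideal (𝓞 k), q.IsPrime → q ≠ ⊥ → (2 : 𝓞 k) ∉ q → ∃ β ∈ B, β ∉ q)
    (hform : ∀ β ∈ B, ∃ a b : ℚ, (β : k) = a + b * r ∧ (∃ m : ℚ, a ^ 2 - D * b ^ 2 = m ^ 3) ∧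
      ∃ t : ℤ, 16 * b = 3 * t) :
    ∀ β ∈ B, ∃ e : k, (β : k) = e ^ 3 := by
  obtain ⟨hsqf, hmod⟩ := D_facts D hD
  have hD1 : D ≠ 1 := by omega
  have hns := nonsq_of_squarefree D hsqf hD1
  have : Algebra.IsQuadraticExtension ℚ k := ⟨h2⟩
  obtain ⟨σ, hσ⟩ := exists_conj (F := ℚ) (Ω := k) (D : ℚ) hns r (by simp [hr])
  have hrI : IsIntegral ℤ r := by
    apply IsIntegral.of_pow (n := 2) (by norm_num)
    rw [hr]; exact isIntegral_algebraMap (R := ℤ) (A := k) (x := D)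
  let R : 𝓞 k := ⟨r, hrI⟩
  have hRr : (R : k) = r := rfl
  have hR2 : R ^ 2 = (D : 𝓞 k) := by
    apply RingOfIntegers.ext
    simp [hRr, hr]
  have h_integral : ∀ z : 𝓞 k, ∃ a b : ℤ, z = (a : 𝓞 k) + b * R := by
    intro z
    obtain ⟨a, b, hab⟩ := quad_repr D hns r hr h2 (z : k)
    have hz : IsIntegral ℤ (z : k) := RingOfIntegers.isIntegral_coe z
    have hz2 : IsIntegral ℤ (σ (z : k)) := hz.map (σ.restrictScalars ℤ)
    have hs : σ (z : k) = a - b * r := by rw [hab]; simp [hσ]; ring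
    rw [hs] at hz2
    rw [hab] at hz
    obtain ⟨A, B, hA, hB⟩ := quad_integral D hsqf hmod r hr a b hz hz2
    refine ⟨A, B, ?_⟩
    apply RingOfIntegers.ext
    rw [hab, hA, hB]; simp [hRr]
  have huniq : ∀ a b a' b' : ℤ, (a : 𝓞 k) + b * R = a' + b' * R → a = a' ∧ b = b' := by
    intro a b a' b' h
    have h' := congrArg (algebraMap (𝓞 k) k) h
    have := quad_unique D hns r hr (a := a) (b := b) (a' := a') (b' := b') (by
      simpa [hRr] using h')
    exact_mod_cast this
  -- a prime above 3
  obtain ⟨q3, hq3max, hq3⟩ := Ideal.exists_le_maximal (Ideal.span {(3 : 𝓞 k)}) (by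
    rw [Ne, Ideal.span_singleton_eq_top]
    intro hu
    obtain ⟨x, hx⟩ := hu.exists_right_inv
    obtain ⟨a, b, hab⟩ := h_integral x
    have := huniq (3 * a) (3 * b) 1 0 (by rw [hab] at hx; push_cast; linear_combination hx)
    omega)
  have h3mem : (3 : 𝓞 k) ∈ q3 := hq3 (Ideal.mem_span_singleton_self _)
  obtain ⟨β, hβB, hβq⟩ := hprime q3 hq3max.isPrime (by
      rintro rfl
      simp at h3mem) (by
    intro h2m
    apply hq3max.ne_top
    rw [Ideal.eq_top_iff_one]
    have : (1 : 𝓞 k) = 3 - 2 := by norm_num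
    rw [this]; exact sub_mem h3mem h2m)
  suffices hmain : ∃ e : k, (β : k) = e ^ 3 by
    obtain ⟨e, he⟩ := hmain
    intro β' hβ'
    obtain ⟨c, hc⟩ := hcube β hβB β' hβ'
    exact ⟨e * c, by rw [hc, he]; ring⟩
  have hβ0 : β ≠ 0 := by rintro rfl; exact h0 hβB
  obtain ⟨a, b, hab⟩ := h_integral β
  obtain ⟨a', b', hab', ⟨m', hm'⟩, ⟨t, ht⟩⟩ := hform β hβB
  obtain ⟨rfl, rfl⟩ := quad_unique D hns r hr (a := a) (b := b) (a' := a') (b' := b') (by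
    rw [← hab', hab]; simp [hRr])
  have h3b : 3 ∣ b := by
    have : 16 * b = 3 * t := by exact_mod_cast ht
    omega
  have h3a : ¬ 3 ∣ a := by
    rintro ⟨a1, rfl⟩
    obtain ⟨b1, rfl⟩ := h3b
    apply hβq
    rw [hab]
    have : (((3 * a1 : ℤ) : 𝓞 k) + ((3 * b1 : ℤ) : 𝓞 k) * R) = 3 * (a1 + b1 * R) := by push_cast; ring
    rw [this]
    exact Ideal.mul_mem_right _ _ h3mem
  obtain ⟨m, rfl⟩ := int_of_isIntegral_rat (F := ℚ) m' (by
    apply IsIntegral.of_pow (n := 3) (by norm_num)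
    simp only [Rat.cast_id]
    rw [← hm']
    have := isIntegral_algebraMap (R := ℤ) (A := ℚ) (x := a ^ 2 - D * b ^ 2)
    simpa using this)
  have hm : a ^ 2 - D * b ^ 2 = m ^ 3 := by exact_mod_cast hm'
  let S : 𝓞 k ≃+* 𝓞 k := RingOfIntegers.mapRingEquiv σ
  have hSc : ∀ x : 𝓞 k, ((S x : 𝓞 k) : k) = σ (x : k) := fun x => rfl
  have hS : ∀ a b : ℤ, S (a + b * R) = a - b * R := by
    intro a b
    apply RingOfIntegers.ext
    rw [hSc]
    simp [hRr, hσ]; ring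
  have hSS : ∀ x : 𝓞 k, S (S x) = x := by
    intro x
    obtain ⟨a, b, rfl⟩ := h_integral x
    rw [hS, show (a : 𝓞 k) - b * R = a + ((-b : ℤ) : 𝓞 k) * R by push_cast; ring, hS]
    push_cast; ring
  obtain ⟨I, hI⟩ := cube_ideal S (by
    intro q hq _ h2q
    have hsub : ∀ x ∈ q, S x ∈ q := by
      intro x hx
      obtain ⟨a, b, hxe⟩ := h_integral x
      have : S x = x - 2 * (b * R) := by rw [hxe, hS]; ring
      rw [this]
      exact sub_mem hx (Ideal.mul_mem_right _ _ h2q)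
    apply le_antisymm
    · rw [Ideal.map_le_iff_le_comap]
      exact hsub
    · intro x hx
      rw [← hSS x]
      exact Ideal.mem_map_of_mem _ (hsub x hx)) β (m : 𝓞 k) hβ0 (by
    rw [hab, hS]
    have : ((a ^ 2 - D * b ^ 2 : ℤ) : 𝓞 k) = ((m ^ 3 : ℤ) : 𝓞 k) := by rw [hm]
    push_cast at this
    rw [← this, ← hR2]; ring) (by
    intro q hq hq0 h2q
    obtain ⟨β', hβ', hβ'q⟩ := hprime q hq hq0 h2q
    obtain ⟨c, hc⟩ := hcube β hβB β' hβ'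
    replace hc : algebraMap (𝓞 k) k β' = algebraMap (𝓞 k) k β * c ^ 3 := hc
    obtain ⟨u, v, hv, huv⟩ := IsFractionRing.div_surjective (A := 𝓞 k) c
    have hv0 : v ≠ 0 := nonZeroDivisors.ne_zero hv
    have hvk : (v : k) ≠ 0 := by exact_mod_cast hv0
    have heq : β * u ^ 3 = β' * v ^ 3 := by
      apply RingOfIntegers.ext
      simp only [map_mul, map_pow]
      rw [hc, ← huv]
      field_simp
    refine ⟨u, v, β', ?_, hv0, hβ'q, heq⟩
    rintro rfl
    have : β' * v ^ 3 = 0 := by rw [← heq]; ring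
    rcases mul_eq_zero.mp this with h | h
    · exact hβ'q (h ▸ q.zero_mem)
    · exact pow_ne_zero 3 hv0 h)
  obtain ⟨c, hc, hc2, hcb⟩ : ∃ c : ℝ, 0 < c ∧ 
      (if D < 0 then 9 * c ^ 4 = 16 * |(D : ℝ)| else 4 * |(D : ℝ)| < c ^ 4) ∧
      ((D = 3 → c ^ 6 < 43) ∧ (D = 6 → c ^ 6 < 120)) := by
    by_cases hneg : D < 0
    · have hDp : 0 < |(D : ℝ)| := by rw [abs_pos]; exact_mod_cast hneg.ne
      refine ⟨Real.sqrt (Real.sqrt (16 / 9 * |(D : ℝ)|)), by positivity, ?_, by omega, by omega⟩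
      rw [if_pos hneg]
      rw [show (4 : ℕ) = 2 * 2 by norm_num, pow_mul, Real.sq_sqrt (by positivity),
        Real.sq_sqrt (by positivity)]
      ring
    · rcases (show D = 3 ∨ D = 6 by
        simp only [Finset.mem_insert, Finset.mem_singleton] at hD; omega) with rfl | rfl
      · exact ⟨1.87, by norm_num, by norm_num, by norm_num⟩
      · exact ⟨2.22, by norm_num, by norm_num, by norm_num⟩
  obtain ⟨γ, ξ, hγ0, hγ, hbd⟩ := quad_small k h2 D hns R hR2 h_integral σ (by rw [hRr, hσ]) β hβ0 I hI c hc hc2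
  obtain ⟨X, Y, hXY⟩ := h_integral ξ
  obtain ⟨g, h, hgh⟩ := h_integral γ
  have hbd := hbd X Y hXY
  have hm0 : m ≠ 0 := by
    rintro rfl
    have h1 : β * S β = 0 := by
      rw [hab, hS]
      have : ((a ^ 2 - D * b ^ 2 : ℤ) : 𝓞 k) = 0 := by rw [hm]; simp
      push_cast at this
      rw [← hR2] at this
      linear_combination this
    rcases mul_eq_zero.mp h1 with h | h
    · exact hβ0 h
    · exact hβ0 (by simpa using h)
  obtain ⟨e1, e2⟩ := huniq (X * a + D * Y * b) (X * b + Y * a) (g ^ 3 + 3 * g * h ^ 2 * D)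
    (3 * g ^ 2 * h + h ^ 3 * D) (by
      rw [hXY, hgh, hab] at hγ
      push_cast
      rw [← hR2]
      linear_combination -hγ)
  obtain ⟨n, hn⟩ : ∃ n : ℤ, X ^ 2 - D * Y ^ 2 = n ^ 3 := by
    have hN : (X ^ 2 - D * Y ^ 2) * m ^ 3 = (g ^ 2 - D * h ^ 2) ^ 3 := by
      rw [← hm]
      have : (X ^ 2 - D * Y ^ 2) * (a ^ 2 - D * b ^ 2) = 
        (X * a + D * Y * b) ^ 2 - D * (X * b + Y * a) ^ 2 := by ring
      rw [this, e1, e2]; ring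
    have : m ∣ g ^ 2 - D * h ^ 2 := by
      rw [← Int.pow_dvd_pow_iff (n := 3) (by norm_num)]
      exact ⟨X ^ 2 - D * Y ^ 2, by rw [← hN]; ring⟩
    obtain ⟨n, hn⟩ := this
    refine ⟨n, ?_⟩
    rw [hn, mul_pow] at hN
    apply mul_right_cancel₀ (pow_ne_zero 3 hm0)
    rw [hN]; ring
  have hξ0 : ξ ≠ 0 := by
    rintro rfl
    rw [zero_mul] at hγ
    exact hγ0 (pow_eq_zero_iff three_ne_zero |>.mp hγ)
  have hn0 : n ≠ 0 := by
    rintro rfl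
    have h1 : ξ * S ξ = 0 := by
      rw [hXY, hS]
      have : ((X ^ 2 - D * Y ^ 2 : ℤ) : 𝓞 k) = 0 := by rw [hn]; simp
      push_cast at this
      rw [← hR2] at this
      linear_combination this
    rcases mul_eq_zero.mp h1 with h | h
    · exact hξ0 h
    · exact hξ0 (by simpa using h)
  obtain ⟨e, he⟩ := xi_cube k D hD r hr X Y n hn hn0 (fun h3D => arith3 D X Y a b g h h3D h3b h3a e1 e2)
    (by
      intro hneg
      rw [if_pos hneg] at hc2
      have hDr : (D : ℝ) < 0 := by exact_mod_cast hneg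
      rw [abs_of_neg hDr] at hbd hc2
      have h1 : ((n : ℝ)) ^ 3 < (c ^ 2) ^ 3 := by
        have : ((X ^ 2 - D * Y ^ 2 : ℤ) : ℝ) = ((n ^ 3 : ℤ) : ℝ) := by rw [hn]
        push_cast at this
        rw [← this]; nlinarith
      have hnpos : 0 < n := by
        have h3 : 0 ≤ n ^ 3 := by rw [← hn]; nlinarith [sq_nonneg X, sq_nonneg Y]
        have : 0 ≤ n := by
          by_contra hc
          push Not at hc
          have := Odd.pow_neg (n := 3) (by decide) hc
          omega
        omega
      have hnr : (0 : ℝ) < n := by exact_mod_cast hnpos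
      have h4 : (n : ℝ) < c ^ 2 := lt_of_pow_lt_pow_left₀ 3 (by positivity) h1
      have h5 : 9 * (n : ℝ) ^ 2 < 16 * (-D) := by rw [← hc2]; nlinarith
      exact_mod_cast h5)
    (by
      intro h3
      have h1 := hcb.1 h3
      subst h3
      have : (X : ℝ) ^ 2 + 3 * Y ^ 2 < 43 := by norm_num at hbd; linarith
      exact_mod_cast this)
    (by
      intro h3
      have h1 := hcb.2 h3
      subst h3
      have : (X : ℝ) ^ 2 + 6 * Y ^ 2 < 120 := by norm_num at hbd; linarith
      exact_mod_cast this)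
  refine ⟨γ / e, ?_⟩
  have hξe : (ξ : k) = e ^ 3 := by rw [hXY, ← he]; simp [hRr]
  have hξk : (ξ : k) ≠ 0 := by exact_mod_cast hξ0
  have hγk : (γ : k) ^ 3 = ξ * β := by simpa using congrArg (algebraMap (𝓞 k) k) hγ
  rw [div_pow, ← hξe, hγk]
  field_simp


theorem d_facts (d : ℕ) (hd : d ∈ ({1, 2, 3, 7, 11, 19, 43, 67, 163} : Finset ℕ)) :
    Squarefree (-(d : ℤ)) ∧ (∀ q : ℚ, q ^ 2 ≠ ((-(d : ℤ) : ℤ) : ℚ)) := by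
  have h1 : Squarefree (-(d : ℤ)) := by
    rw [← Int.squarefree_natAbs]
    simp only [Int.natAbs_neg, Int.natAbs_natCast]
    simp only [Finset.mem_insert, Finset.mem_singleton] at hd
    rcases hd with rfl|rfl|rfl|rfl|rfl|rfl|rfl|rfl|rfl <;> apply squarefree_small <;> decide
  exact ⟨h1, nonsq_of_squarefree _ h1 (by omega)⟩

theorem unit_form (d : ℕ) (hd : d ∈ ({1, 2, 3, 7, 11, 19, 43, 67, 163} : Finset ℕ))
    (K : Type) [Field K] [NumberField K]
    (s : K) (hs : s ^ 2 = -(d : K)) (hK : Module.finrank ℚ K = 2) (u : (𝓞 K)ˣ) :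
    ∃ A B : ℤ, 2 * ((u : 𝓞 K) : K) = A + B * s ∧ A ^ 2 + d * B ^ 2 = 4 := by
  obtain ⟨hsqf, hns⟩ := d_facts d hd
  have hs' : s ^ 2 = ((-(d : ℤ) : ℤ) : K) := by push_cast; exact hs
  have : Algebra.IsQuadraticExtension ℚ K := ⟨hK⟩
  obtain ⟨σ, hσ⟩ := exists_conj (F := ℚ) (Ω := K) _ hns s (by rw [hs']; simp)
  have main : ∀ z : 𝓞 K, ∃ A B C : ℤ, 2 * (z : K) = A + B * s ∧ A ^ 2 + d * B ^ 2 = 4 * C ∧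
      (z : K) * σ (z : K) = C := by
    intro z
    obtain ⟨a, b, hab⟩ := quad_repr _ hns s hs' hK (z : K)
    have hz : IsIntegral ℤ (z : K) := RingOfIntegers.isIntegral_coe z
    have hz2 : IsIntegral ℤ (σ (z : K)) := hz.map (σ.restrictScalars ℤ)
    have hs : σ (z : K) = a - b * s := by rw [hab]; simp [hσ]; ring
    rw [hs] at hz2
    rw [hab] at hz
    obtain ⟨A, B, C, hA, hB, hC⟩ := quad_integral2 _ hsqf s hs' a b hz hz2
    have hA' : 2 * (a : K) = A := by exact_mod_cast congrArg (Rat.cast (K := K)) hA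
    have hB' : 2 * (b : K) = B := by exact_mod_cast congrArg (Rat.cast (K := K)) hB
    have hC' : (A : K) ^ 2 + d * B ^ 2 = 4 * C := by 
      have := congrArg (Int.cast (R := K)) hC
      push_cast at this
      linear_combination this
    refine ⟨A, B, C, ?_, ?_, ?_⟩
    · rw [hab, ← hA', ← hB']; ring
    · linarith
    · rw [hs, hab]
      have h4 : (4 : K) ≠ 0 := by norm_num
      apply mul_left_cancel₀ h4
      rw [← hC', ← hA', ← hB']
      push_cast at hs'
      linear_combination (-4 * (b : K) ^ 2) * hs'
  obtain ⟨A, B, C, h1, h2, h3⟩ := main u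
  obtain ⟨A', B', C', h1', h2', h3'⟩ := main (u⁻¹ : (𝓞 K)ˣ)
  have hCC : C * C' = 1 := by
    have : (C : K) * C' = 1 := by
      rw [← h3, ← h3']
      have e : ((u : 𝓞 K) : K) * (((u⁻¹ : (𝓞 K)ˣ) : 𝓞 K) : K) = 1 := by
        have := congrArg (algebraMap (𝓞 K) K) (Units.mul_inv u)
        simpa using this
      have e2 := congrArg σ e
      rw [map_mul, map_one] at e2
      calc _ = (((u : 𝓞 K) : K) * (((u⁻¹ : (𝓞 K)ˣ) : 𝓞 K) : K)) * (σ ((u : 𝓞 K) : K) * σ (((u⁻¹ : (𝓞 K)ˣ) : 𝓞 K) : K)) := by ring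
        _ = 1 := by rw [e, e2, one_mul]
    exact_mod_cast this
  have hC0 : 0 ≤ C := by
    have : 0 ≤ 4 * C := by rw [← h2]; positivity
    linarith
  have hC1 : C = 1 := by
    rcases Int.isUnit_iff.mp (IsUnit.of_mul_eq_one _ hCC) with h | h <;> omega
  exact ⟨A, B, h1, by rw [h2, hC1]; ring⟩

theorem unit_facts (d : ℕ) (hd : d ∈ ({1, 2, 3, 7, 11, 19, 43, 67, 163} : Finset ℕ))
    (K : Type) [Field K] [NumberField K]
    (s : K) (hs : s ^ 2 = -(d : K)) (hK : Module.finrank ℚ K = 2)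
    (ε : (𝓞 K)ˣ) (hε : ∀ t : (𝓞 K)ˣ, t ∈ Subgroup.zpowers ε) :
    (∀ x : K, x ^ 2 ≠ ((ε : 𝓞 K) : K)) ∧ ∃ δ : ℤ, ∃ μ : 𝓞 K, μ ≠ 0 ∧
      -12 * ((ε : 𝓞 K) : K) = (μ : K) ^ 2 * δ ∧ ((d = 1 ∧ δ = 6) ∨ (d ≠ 1 ∧ δ = 3)) := by
  obtain ⟨hsqf, hns⟩ := d_facts d hd
  have hs' : s ^ 2 = ((-(d : ℤ) : ℤ) : K) := by push_cast; exact hs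
  have hodd : ∀ n : ℤ, Odd n → ε ^ n ≠ 1 := by
    intro n hn h
    obtain ⟨m, hm⟩ := Subgroup.mem_zpowers_iff.mp (hε (-1))
    have h1 : ((-1 : (𝓞 K)ˣ)) ^ n = 1 := by rw [← hm, ← zpow_mul, mul_comm, zpow_mul, h, one_zpow]
    rw [hn.neg_one_zpow] at h1
    have := congrArg (fun x : (𝓞 K)ˣ => (x : 𝓞 K)) h1
    simp only [Units.val_neg, Units.val_one] at this
    norm_num at this
  constructor
  · intro x hx
    have hxI : IsIntegral ℤ x := by
      apply IsIntegral.of_pow (n := 2) (by norm_num)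
      rw [hx]; exact RingOfIntegers.isIntegral_coe _
    let X : 𝓞 K := ⟨x, hxI⟩
    have hX : X * X = ε := by
      apply RingOfIntegers.ext
      change x * x = _
      rw [← pow_two]; exact hx
    have hu : IsUnit X := isUnit_of_mul_isUnit_left (hX ▸ ε.isUnit)
    obtain ⟨v, hv⟩ := hu
    obtain ⟨n, hn⟩ := Subgroup.mem_zpowers_iff.mp (hε v)
    apply hodd (2 * n - 1) ⟨n - 1, by ring⟩
    have h2 : v * v = ε := by apply Units.ext; rw [Units.val_mul, hv, hX]
    have h3 : ε ^ (2 * n) = ε := by rw [two_mul, zpow_add, hn, h2]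
    rw [zpow_sub_one, h3, mul_inv_cancel]
  · have hε1 : ((ε : 𝓞 K) : K) ≠ 1 := by
      intro h
      apply hodd 1 (by decide)
      rw [zpow_one]; apply Units.ext; apply RingOfIntegers.ext; simpa using h
    have hε3 : ((ε : 𝓞 K) : K) ^ 3 ≠ 1 := by
      intro h
      apply hodd 3 (by decide)
      apply Units.ext; apply RingOfIntegers.ext
      rw [show (3 : ℤ) = ((3 : ℕ) : ℤ) by rfl, zpow_natCast]
      simpa using h
    obtain ⟨A, B, hAB, hN⟩ := unit_form d hd K s hs hK ε
    have hB0 : B = 0 → ((ε : 𝓞 K) : K) = -1 := by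
      rintro rfl
      have : A ^ 2 = 4 := by linarith
      have h2 : (A - 2) * (A + 2) = 0 := by linarith
      rcases mul_eq_zero.mp h2 with h | h
      · have : A = 2 := by omega
        subst this
        exfalso; apply hε1
        push_cast at hAB
        have : (2 : K) ≠ 0 := two_ne_zero
        apply mul_left_cancel₀ this; linear_combination hAB
      · have : A = -2 := by omega
        subst this
        push_cast at hAB
        have : (2 : K) ≠ 0 := two_ne_zero
        apply mul_left_cancel₀ this; linear_combination hAB
    by_cases hd1 : d = 1
    · subst hd1
      have hsI : IsIntegral ℤ s := by
        apply IsIntegral.of_pow (n := 2) (by norm_num)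
        rw [hs']; exact isIntegral_algebraMap (R := ℤ) (A := K) (x := -1)
      let S : 𝓞 K := ⟨s, hsI⟩
      have hSs : (S : K) = s := rfl
      have hs1 : s ^ 2 = -1 := by simpa using hs
      have hA0 : A = 0 := by
        by_contra hA
        have hAp : 1 ≤ A ^ 2 := by have := sq_nonneg A; have : A ^ 2 ≠ 0 := by positivity
                                   omega
        have hN' : A ^ 2 + B ^ 2 = 4 := by push_cast at hN; linarith
        have hB : B = 0 := by
          have a1 : A ≤ 2 := by nlinarith
          have a2 : -2 ≤ A := by nlinarith
          have b1 : B ≤ 1 := by nlinarith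
          have b2 : -1 ≤ B := by nlinarith
          interval_cases A <;> interval_cases B <;> omega
        have he := hB0 hB
        have hSu : IsUnit S := by
          apply IsUnit.of_mul_eq_one (-S)
          apply RingOfIntegers.ext
          change s * -s = 1
          linear_combination -hs1
        obtain ⟨v, hv⟩ := hSu
        obtain ⟨n, hn⟩ := Subgroup.mem_zpowers_iff.mp (hε v)
        have hε' : ε = -1 := by
          apply Units.ext; apply RingOfIntegers.ext; simpa using he
        have hv2 : v * v = 1 := by
          rw [← hn, ← zpow_add, ← two_mul, zpow_mul, hε']; simp
        have h3 : s * s = 1 := by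
          have := congrArg (fun x : (𝓞 K)ˣ => ((x : 𝓞 K) : K)) hv2
          simp only [Units.val_mul, hv] at this
          simpa [hSs] using this
        have : (2 : K) = 0 := by linear_combination hs1 - h3
        exact two_ne_zero this
      subst hA0
      have hBB : (B - 2) * (B + 2) = 0 := by push_cast at hN; linarith
      have h2 : (2 : K) ≠ 0 := two_ne_zero
      rcases mul_eq_zero.mp hBB with h | h
      · have hB : B = 2 := by omega
        subst hB
        have he : ((ε : 𝓞 K) : K) = s := by
          apply mul_left_cancel₀ h2; push_cast at hAB; linear_combination hAB
        refine ⟨6, 1 - S, ?_, ?_, Or.inl ⟨rfl, rfl⟩⟩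
        · intro h
          have : (1 : K) - s = 0 := by simpa [hSs] using congrArg (algebraMap (𝓞 K) K) h
          have : s = 1 := by linear_combination -this
          rw [this] at hs1
          norm_num at hs1
        · rw [he]; change -12 * s = (1 - s) ^ 2 * _; push_cast; linear_combination (-6) * hs1
      · have hB : B = -2 := by omega
        subst hB
        have he : ((ε : 𝓞 K) : K) = -s := by
          apply mul_left_cancel₀ h2; push_cast at hAB; linear_combination hAB
        refine ⟨6, 1 + S, ?_, ?_, Or.inl ⟨rfl, rfl⟩⟩
        · intro h
          have : (1 : K) + s = 0 := by simpa [hSs] using congrArg (algebraMap (𝓞 K) K) h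
          have : s = -1 := by linear_combination this
          rw [this] at hs1
          norm_num at hs1
        · rw [he]; change -12 * (-s) = (1 + s) ^ 2 * _; push_cast; linear_combination (-6) * hs1
    · suffices hη : ∃ η : K, η ^ 2 = -((ε : 𝓞 K) : K) by
        obtain ⟨η, hη⟩ := hη
        have hI : IsIntegral ℤ η := by
          apply IsIntegral.of_pow (n := 2) (by norm_num)
          rw [hη]; exact (RingOfIntegers.isIntegral_coe _).neg
        let E : 𝓞 K := ⟨η, hI⟩
        have hE : (E : K) = η := rfl
        refine ⟨3, 2 * E, ?_, ?_, Or.inr ⟨hd1, rfl⟩⟩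
        · intro h
          have h1 : 2 * η = 0 := by simpa [hE] using congrArg (algebraMap (𝓞 K) K) h
          have h2 : η = 0 := by simpa using h1
          rw [h2] at hη
          have h3 : ((ε : 𝓞 K) : K) = 0 := by linear_combination hη
          have h4 : (ε : 𝓞 K) = 0 := by exact_mod_cast h3
          exact ε.ne_zero h4
        · change _ = (2 * η) ^ 2 * _; push_cast; linear_combination (-12) * hη
      by_cases hd3 : d = 3
      · subst hd3
        by_cases hB : B = 0
        · exact ⟨1, by rw [hB0 hB]; ring⟩
        · push_cast at hN
          have a1 : A ≤ 2 := by nlinarith [sq_nonneg B]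
          have a2 : -2 ≤ A := by nlinarith [sq_nonneg B]
          have b1 : B ≤ 1 := by nlinarith [sq_nonneg A]
          have b2 : -1 ≤ B := by nlinarith [sq_nonneg A]
          have hs3 : s ^ 2 = -3 := by simpa using hs
          have h2 : (2 : K) ≠ 0 := two_ne_zero
          have hB2 : B ^ 2 = 1 := by
            rcases (show B = 1 ∨ B = -1 by omega) with h | h <;> subst h <;> norm_num
          have hA2 : A = 1 ∨ A = -1 := by
            have : (A - 1) * (A + 1) = 0 := by nlinarith
            rcases mul_eq_zero.mp this with h | h <;> omega
          have hBK : (B : K) ^ 2 = 1 := by exact_mod_cast hB2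
          have he : ((ε : 𝓞 K) : K) = (A + B * s) / 2 := by
            rw [← hAB]; field_simp
          rcases hA2 with h | h <;> subst h
          · refine ⟨(-1 + B * s) / 2, ?_⟩
            rw [he]
            push_cast
            linear_combination (1 / 4 : K) * (B : K) ^ 2 * hs3 - 3 / 4 * hBK
          · exfalso
            apply hε3
            rw [he]
            push_cast
            linear_combination (-3 / 8 * (B : K) ^ 2 + 1 / 8 * (B : K) ^ 3 * s) * hs3 + (9 / 8 - 3 / 8 * (B : K) * s) * hBK
      · refine ⟨1, ?_⟩
        rw [hB0 ?_]; · ring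
        simp only [Finset.mem_insert, Finset.mem_singleton] at hd
        by_contra hB
        have hBp : 1 ≤ B ^ 2 := by have := sq_nonneg B; have : B ^ 2 ≠ 0 := by positivity
                                   omega
        by_cases hd2 : d = 2
        · subst hd2
          push_cast at hN
          have b1 : B ≤ 1 := by nlinarith [sq_nonneg A]
          have b2 : -1 ≤ B := by nlinarith [sq_nonneg A]
          have a1 : A ≤ 2 := by nlinarith [sq_nonneg B]
          have a2 : -2 ≤ A := by nlinarith [sq_nonneg B]
          interval_cases A <;> interval_cases B <;> omega
        · have : (7 : ℤ) ≤ d := by omega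
          nlinarith [sq_nonneg A]


theorem S3_gens {G : Type*} [Group G] (e : G ≃* Equiv.Perm (Fin 3)) :
    ∃ σ ρ : G, σ ^ 3 = 1 ∧ ρ ^ 2 = 1 ∧ ρ * σ = σ ^ 2 * ρ ∧
      Function.Bijective (fun p : Fin 3 × Fin 2 => σ ^ (p.1 : ℕ) * ρ ^ (p.2 : ℕ)) := by
  have key : Function.Bijective (fun p : Fin 3 × Fin 2 => 
      (finRotate 3) ^ (p.1 : ℕ) * (Equiv.swap (1 : Fin 3) 2) ^ (p.2 : ℕ)) := by
    decide
  refine ⟨e.symm (finRotate 3), e.symm (Equiv.swap 1 2), ?_, ?_, ?_, ?_⟩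
  · rw [← map_pow, show (finRotate 3) ^ 3 = 1 by decide, map_one]
  · rw [← map_pow, show (Equiv.swap (1 : Fin 3) 2) ^ 2 = 1 by decide, map_one]
  · rw [← map_pow, ← map_mul, ← map_mul]
    congr 1; decide
  · have := e.symm.bijective.comp key
    convert this using 2
    simp

theorem gal_fixed {K L : Type*} [Field K] [Field L] [Algebra K L] [FiniteDimensional K L] [IsGalois K L]
    (σ ρ : L ≃ₐ[K] L) (hb : Function.Surjective (fun p : Fin 3 × Fin 2 => σ ^ (p.1 : ℕ) * ρ ^ (p.2 : ℕ)))
    (a : L) (h1 : σ a = a) (h2 : ρ a = a) : ∃ b : K, algebraMap K L b = a := by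
  have h : ∀ f : L ≃ₐ[K] L, f a = a := by
    intro f
    obtain ⟨⟨i, j⟩, rfl⟩ := hb f
    have e1 : ∀ n : ℕ, (σ ^ n) a = a := by
      intro n; induction n with
      | zero => rfl
      | succ n ih => rw [pow_succ, AlgEquiv.mul_apply, h1, ih]
    have e2 : ∀ n : ℕ, (ρ ^ n) a = a := by
      intro n; induction n with
      | zero => rfl
      | succ n ih => rw [pow_succ, AlgEquiv.mul_apply, h2, ih]
    simp only [AlgEquiv.mul_apply, e1, e2]
  exact (IsGalois.mem_range_algebraMap_iff_fixed a).mpr h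

theorem y_action {K L : Type*} [Field K] [Field L] [CharZero L] [Algebra K L] [FiniteDimensional K L] [IsGalois K L]
    (σ ρ : L ≃ₐ[K] L) (hσ : σ ^ 3 = 1)
    (hb : Function.Surjective (fun p : Fin 3 × Fin 2 => σ ^ (p.1 : ℕ) * ρ ^ (p.2 : ℕ)))
    (ε : K) (hε : ∀ x : K, x ^ 2 ≠ ε) (y : L) (hy : y ^ 2 = algebraMap K L ε) :
    σ y = y ∧ ρ y = -y := by
  have hpm : ∀ f : L ≃ₐ[K] L, f y = y ∨ f y = -y := by
    intro f
    have : (f y) ^ 2 = y ^ 2 := by rw [← map_pow, hy, AlgEquiv.commutes]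
    exact sq_eq_sq_iff_eq_or_eq_neg.mp this
  have hy0 : y ≠ -y := by
    intro h
    have : y = 0 := by
      have h2 : (2 : L) * y = 0 := by linear_combination h
      simpa using h2
    apply hε 0
    rw [this] at hy
    have : algebraMap K L ε = 0 := by rw [← hy]; ring
    have h0 : ε = 0 := by simpa using this
    rw [h0]; ring
  have h1 : σ y = y := by
    rcases hpm σ with h | h
    · exact h
    · exfalso
      have h3 : (σ ^ 3) y = y := by rw [hσ]; rfl
      rw [pow_succ, pow_two, AlgEquiv.mul_apply, AlgEquiv.mul_apply] at h3
      simp only [map_neg, h, neg_neg] at h3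
      exact hy0 h3.symm
  refine ⟨h1, ?_⟩
  rcases hpm ρ with h | h
  · exfalso
    obtain ⟨b, hb'⟩ := gal_fixed σ ρ hb y h1 h
    apply hε b
    apply (algebraMap K L).injective
    rw [map_pow, hb', hy]
  · exact h


theorem gal_smul_coe {K L : Type} [Field K] [NumberField K] [Field L] [NumberField L] [Algebra K L]
    (g : L ≃ₐ[K] L) (z : 𝓞 L) : ((g • z : 𝓞 L) : L) = g (z : L) := rfl

theorem inertia_trivial {K L : Type} [Field K] [NumberField K] [Field L] [NumberField L] [Algebra K L]
    [IsGalois K L] (Q : Ideal (𝓞 L)) [Q.IsPrime] 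
    (hp : Q.comap (algebraMap (𝓞 K) (𝓞 L)) ≠ ⊥)
    (hram : Ideal.ramificationIdx' (Q.comap (algebraMap (𝓞 K) (𝓞 L))) Q = 1)
    (g : L ≃ₐ[K] L) (hg : ∀ z : 𝓞 L, g • z - z ∈ Q) : g = 1 := by
  let p := Q.under (𝓞 K)
  have hpp : p.IsPrime := inferInstance
  have hp : p ≠ ⊥ := hp
  have hram : Ideal.ramificationIdx' p Q = 1 := hram
  have : p.IsMaximal := Ideal.IsPrime.isMaximal hpp hp
  rw [Ideal.ramificationIdx'_eq_ramificationIdx p Q hp] at hram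
  have : Finite ((𝓞 K) ⧸ p) := Ring.HasFiniteQuotients.finiteQuotient hp
  have : PerfectField p.ResidueField := by
    have : Finite p.ResidueField := by
      have h := (Ideal.bijective_algebraMap_quotient_residueField p)
      exact Finite.of_surjective _ h.2
    infer_instance
  have h := Ideal.card_inertia_eq_ramificationIdxIn (G := Gal(L/K)) p Q
  rw [Ideal.ramificationIdxIn_eq_ramificationIdx p Q Gal(L/K), hram] at h
  have hs : Q.inertia Gal(L/K) = ⊥ := Subgroup.card_eq_one.mp h
  have : g ∈ Q.inertia Gal(L/K) := hg
  rw [hs] at this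
  exact this

theorem hom_nonvanish {K L : Type} [Field K] [NumberField K] [Field L] [NumberField L] [Algebra K L]
    [IsGalois K L]
    (hunr : ∀ P : Ideal (𝓞 K), P.IsPrime → P ≠ ⊥ → (2 : 𝓞 K) ∉ P →
      ∀ Q : Ideal (𝓞 L), Q.IsPrime → Q.comap (algebraMap (𝓞 K) (𝓞 L)) = P →
        Ideal.ramificationIdx' P Q = 1)
    (σ ρ : L ≃ₐ[K] L)
    (hb : Function.Injective (fun p : Fin 3 × Fin 2 => σ ^ (p.1 : ℕ) * ρ ^ (p.2 : ℕ)))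
    {T : Type*} [CommRing T] [IsDomain T] (f : 𝓞 L →+* T) (h2 : (2 : T) ≠ 0) (w : T) :
    ∃ z : 𝓞 L, f (z + ρ • z) + w * f (σ • (z + ρ • z)) + w ^ 2 * f (σ • σ • (z + ρ • z)) ≠ 0 := by
  by_contra hcon
  push Not at hcon
  have hinj : ∀ g : L ≃ₐ[K] L, (∀ z : 𝓞 L, f (g • z) = f z) → g = 1 := by
    intro g hg
    have hker : ∀ z : 𝓞 L, g • z - z ∈ RingHom.ker f := by
      intro z; rw [RingHom.mem_ker, map_sub, hg, sub_self]
    by_cases hp : (RingHom.ker f).comap (algebraMap (𝓞 K) (𝓞 L)) = ⊥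
    · have hbot : RingHom.ker f = ⊥ := Ideal.eq_bot_of_comap_eq_bot hp
      apply AlgEquiv.ext
      intro x
      obtain ⟨u, v, hv, rfl⟩ := IsFractionRing.div_surjective (A := 𝓞 L) x
      have hfix : ∀ z : 𝓞 L, g (algebraMap (𝓞 L) L z) = algebraMap (𝓞 L) L z := by
        intro z
        have := hker z
        rw [hbot, Ideal.mem_bot, sub_eq_zero] at this
        exact congrArg (algebraMap (𝓞 L) L) this
      rw [map_div₀, hfix, hfix]; rfl
    · have hk : (RingHom.ker f).IsPrime := RingHom.ker_isPrime f
      exact inertia_trivial (RingHom.ker f) hp (hunr _ inferInstance hp (by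
        rw [Ideal.mem_comap, RingHom.mem_ker, map_ofNat, map_ofNat]; exact h2) _ hk rfl) g hker
  let χ : (L ≃ₐ[K] L) → (𝓞 L →* T) := fun g => 
    (f.comp (MulSemiringAction.toRingHom (L ≃ₐ[K] L) (𝓞 L) g)).toMonoidHom
  have hχ : ∀ g z, χ g z = f (g • z) := fun g z => rfl
  have hχinj : Function.Injective χ := by
    intro g g' h
    have : g * g'⁻¹ = 1 := by
      apply hinj
      intro z
      have := DFunLike.congr_fun h (g'⁻¹ • z)
      rw [hχ, hχ, smul_inv_smul] at this
      rw [mul_smul, this]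
    exact mul_inv_eq_one.mp this
  have hli := (linearIndependent_monoidHom (𝓞 L) T).comp _ (hχinj.comp hb)
  rw [Fintype.linearIndependent_iff] at hli
  have := hli (fun p => w ^ (p.1 : ℕ)) (by
    funext z
    have h := hcon z
    simp only [Fintype.sum_prod_type, Fin.sum_univ_three, Fin.sum_univ_two]
    simp [hχ, mul_smul, pow_two]
    simp only [smul_add, map_add] at h
    linear_combination h) (0, 0)
  simp at this


theorem lift_prime {A B : Type*} [CommRing A] [CommRing B] (i : A →+* B)
    (hi : Function.Injective i) (hB : ∀ x : B, IsIntegral ℤ x) (q : Ideal A) (hq : q.IsPrime) :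
    ∃ P : Ideal B, P.IsPrime ∧ P.comap i = q := by
  let := i.toAlgebra
  have h_integral : Algebra.IsIntegral A B := ⟨fun x => (hB x).tower_top⟩
  obtain ⟨P, -, hP, hPq⟩ := Ideal.exists_ideal_over_prime_of_isIntegral q (⊥ : Ideal B) (by
    intro x hx
    rw [Ideal.mem_comap] at hx
    have hx0 : i x = 0 := hx
    rw [(map_eq_zero_iff i hi).mp hx0]
    exact q.zero_mem)
  exact ⟨P, hP, hPq⟩

theorem key_omega {Ω : Type*} [Field Ω] [CharZero Ω]
    (D : ℤ) (hD : D ∈ ({3, 6, -1, -6, -21, -33, -57, -129, -201, -489} : Finset ℤ))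
    (r : Ω) (hr : r ^ 2 = (D : Ω)) {Z : Type*} (β : Z → integralClosure ℤ Ω)
    (hcube : ∀ z z', β z ≠ 0 → β z' ≠ 0 → ∃ a b : ℚ, (β z' : Ω) = β z * (a + b * r) ^ 3)
    (hprime : ∀ P : Ideal (integralClosure ℤ Ω), P.IsPrime → (2 : integralClosure ℤ Ω) ∉ P → 
      ∃ z, β z ∉ P)
    (hform : ∀ z, ∃ a b : ℚ, (β z : Ω) = a + b * r ∧ (∃ m : ℚ, a ^ 2 - D * b ^ 2 = m ^ 3) ∧
      ∃ t : ℤ, 16 * b = 3 * t) :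
    ∀ z, β z ≠ 0 → ∃ a b : ℚ, (β z : Ω) = (a + b * r) ^ 3 := by
  obtain ⟨hsqf, hmod⟩ := D_facts D hD
  have hns := nonsq_of_squarefree D hsqf (by omega)
  have hrI : IsIntegral ℚ r := by
    apply IsIntegral.of_pow (n := 2) (by norm_num)
    rw [hr]
    have := isIntegral_algebraMap (R := ℚ) (A := Ω) (x := (D : ℚ))
    simpa using this
  let k := IntermediateField.adjoin ℚ {r}
  have hfr : Module.finrank ℚ k = 2 := by
    rw [IntermediateField.adjoin.finrank hrI]
    have hmon : (Polynomial.X ^ 2 - Polynomial.C (D : ℚ) : Polynomial ℚ).Monic :=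
      Polynomial.monic_X_pow_sub_C _ two_ne_zero
    have hirr : Irreducible (Polynomial.X ^ 2 - Polynomial.C (D : ℚ) : Polynomial ℚ) := by
      apply X_pow_sub_C_irreducible_of_prime Nat.prime_two hns
    rw [← minpoly.eq_of_irreducible_of_monic hirr (by simp [hr]) hmon]
    exact Polynomial.natDegree_X_pow_sub_C
  have : FiniteDimensional ℚ k := Module.finite_of_finrank_pos (by omega)
  have : NumberField k := ⟨⟩
  let r' : k := ⟨r, IntermediateField.mem_adjoin_simple_self ℚ r⟩
  have hr'c : (r' : Ω) = r := rfl
  have hr' : r' ^ 2 = (D : k) := by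
    apply Subtype.ext; simp [hr'c, hr]
  have hcoe : ∀ a b : ℚ, (((a : k) + b * r' : k) : Ω) = a + b * r := by
    intro a b; simp [hr'c]
  have hmem : ∀ z, (β z : Ω) ∈ k := by
    intro z
    obtain ⟨a, b, hab, -⟩ := hform z
    rw [hab, ← hcoe]; exact SetLike.coe_mem _
  have hkI : ∀ x : k, IsIntegral ℤ (x : Ω) → IsIntegral ℤ x := by
    intro x hx
    exact (isIntegral_algebraMap_iff (algebraMap k Ω).injective).mp hx
  let b : Z → 𝓞 k := fun z => ⟨⟨β z, hmem z⟩, hkI _ (β z).2⟩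
  have hbc : ∀ z, (((b z : 𝓞 k) : k) : Ω) = β z := fun z => rfl
  have hb0 : ∀ z, b z = 0 ↔ β z = 0 := by
    intro z
    constructor
    · intro h
      apply Subtype.ext
      rw [← hbc z, h]; simp
    · intro h
      apply RingOfIntegers.ext
      apply Subtype.ext
      rw [hbc z, h]; simp
  let i : 𝓞 k →+* integralClosure ℤ Ω :=
    { toFun := fun x => ⟨((x : k) : Ω), (RingOfIntegers.isIntegral_coe x).map (algebraMap k Ω).toIntAlgHom⟩
      map_one' := by apply Subtype.ext; simp
      map_zero' := by apply Subtype.ext; simp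
      map_mul' := by intro x y; apply Subtype.ext; simp
      map_add' := by intro x y; apply Subtype.ext; simp }
  have hib : ∀ z, i (b z) = β z := fun z => rfl
  have hiinj : Function.Injective i := by
    intro x y hxy
    have := congrArg Subtype.val hxy
    apply RingOfIntegers.ext
    apply Subtype.ext
    exact this
  have hfin := key_lemma k hfr D hD r' hr' {x | ∃ z, β z ≠ 0 ∧ b z = x} (by
      rintro ⟨z, hz, hz2⟩
      exact hz ((hb0 z).mp hz2)) (by
      rintro _ ⟨z, hz, rfl⟩ _ ⟨z', hz', rfl⟩
      obtain ⟨a, b', hab⟩ := hcube z z' hz hz'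
      refine ⟨a + b' * r', ?_⟩
      apply Subtype.ext
      change (β z' : Ω) = β z * (((a : k) + b' * r' : k) : Ω) ^ 3
      rw [hcoe, hab]) (by
      intro q hq hq0 h2
      obtain ⟨P, hP, hPq⟩ := lift_prime i hiinj (fun x => Algebra.IsIntegral.isIntegral x) q hq
      obtain ⟨z, hz⟩ := hprime P hP (by
        intro h
        apply h2
        rw [← hPq, Ideal.mem_comap, map_ofNat]
        exact h)
      refine ⟨b z, ⟨z, ?_, rfl⟩, ?_⟩
      · rintro h0; rw [h0] at hz; exact hz P.zero_mem
      · intro hb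
        apply hz
        rw [← hPq, Ideal.mem_comap] at hb
        exact hb) (by
      rintro _ ⟨z, hz, rfl⟩
      obtain ⟨a, b', hab, h⟩ := hform z
      refine ⟨a, b', ?_, h⟩
      apply Subtype.ext
      rw [hcoe, ← hab]; rfl)
  intro z hz
  obtain ⟨e, he⟩ := hfin (b z) ⟨z, hz, rfl⟩
  obtain ⟨a, b', hab⟩ := quad_repr D hns r' hr' hfr e
  refine ⟨a, b', ?_⟩
  rw [← hbc, he, hab]
  push_cast
  rw [hr'c]


theorem beta_cube {Ω : Type*} [Field Ω] [CharZero Ω]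
    (D : ℤ) (hD : D ∈ ({3, 6, -1, -6, -21, -33, -57, -129, -201, -489} : Finset ℤ))
    (r s Δ η : Ω) (hr : r ^ 2 = (D : Ω)) (d : ℕ) (hd : d ≠ 0) (hs : s ^ 2 = -(d : Ω))
    (τ : Ω →+* Ω) (hτs : τ s = -s) (hτΔ : τ Δ = η * Δ)
    (hF1 : ∀ a b a' b' : ℚ, ∃ X Y : ℚ,
      ((a + b * s) + (a' + b' * s) * Δ) * ((a - b * s) + (a' - b' * s) * (η * Δ)) = X + Y * r)
    (hF2 : ∀ A B A' B' : ℤ, ∃ X : ℚ, ∃ t : ℤ,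
      (2 * (A + B * s) + 3 * (A' + B' * s) * Δ) * (2 * (A - B * s) + 3 * (A' - B' * s) * (η * Δ))
        = X + 12 * t * r ∧
      (2 * (A + B * s) - 3 * (A' + B' * s) * Δ) * (2 * (A - B * s) - 3 * (A' - B' * s) * (η * Δ))
        = X - 12 * t * r)
    {Z : Type*} (R R' : Z → Ω)
    (h_integral : ∀ z, IsIntegral ℤ (R z))
    (hcub : ∀ z, ∃ A B A' B' : ℤ, 8 * R z ^ 3 = 2 * (A + B * s) + 3 * (A' + B' * s) * Δ ∧
      8 * R' z ^ 3 = 2 * (A + B * s) - 3 * (A' + B' * s) * Δ)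
    (hnorm : ∀ z, ∃ e f : ℚ, R z * R' z = e + f * s)
    (hRR : ∀ z, R z ≠ 0 → R' z ≠ 0)
    (hprod : ∀ z z', ∃ a b a' b' : ℚ, R z * R' z' = (a + b * s) + (a' + b' * s) * Δ)
    (hprime : ∀ P : Ideal (integralClosure ℤ Ω), P.IsPrime → (2 : integralClosure ℤ Ω) ∉ P → 
      ∃ z, ∀ x : integralClosure ℤ Ω, (x : Ω) = R z * τ (R z) → x ∉ P) :
    ∀ z, R z ≠ 0 → ∃ a b : ℚ, R z ^ 3 * τ (R z) ^ 3 = (a + b * r) ^ 3 := by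
  have hτint : ∀ z, IsIntegral ℤ (R z * τ (R z)) := fun z =>
    (h_integral z).mul (map_isIntegral_int τ (h_integral z))
  let γ : Z → integralClosure ℤ Ω := fun z => ⟨R z * τ (R z), hτint z⟩
  have hγ : ∀ z, (γ z : Ω) = R z * τ (R z) := fun z => rfl
  have hβ : ∀ z, ((γ z ^ 3 : integralClosure ℤ Ω) : Ω) = R z ^ 3 * τ (R z) ^ 3 := by
    intro z; push_cast; rw [hγ, mul_pow]
  have hne : ∀ z, γ z ^ 3 ≠ 0 → R z ≠ 0 := by
    intro z h h0
    apply h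
    have : γ z = 0 := Subtype.ext (by rw [hγ, h0, zero_mul]; rfl)
    rw [this]; ring
  have key := key_omega D hD r hr (fun z => γ z ^ 3) ?_ ?_ ?_
  · intro z hz
    have := key z (by
      apply pow_ne_zero
      intro h
      have h1 := hγ z
      rw [h] at h1
      have h2 : τ (R z) ≠ 0 := (map_ne_zero τ).mpr hz
      exact (mul_ne_zero hz h2) h1.symm)
    simpa only [hβ] using this
  · intro z z' hz hz'
    have h0 := hne z hz
    have h0' := hRR z h0
    obtain ⟨e, f, hef⟩ := hnorm z
    obtain ⟨a, b, a', b', hp⟩ := hprod z' z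
    have hN : (e ^ 2 + d * f ^ 2 : ℚ) ≠ 0 := by
      intro h
      have hd' : (0 : ℚ) < d := by exact_mod_cast Nat.pos_of_ne_zero hd
      have hf : f = 0 := by
        by_contra hf
        have : 0 < f ^ 2 := by positivity
        nlinarith [sq_nonneg e]
      have he : e = 0 := by
        rw [hf] at h; simpa using h
      rw [he, hf] at hef
      simp [h0, h0'] at hef
    have hNΩ : ((e : Ω) ^ 2 + d * f ^ 2) ≠ 0 := by exact_mod_cast hN
    set N : ℚ := e ^ 2 + d * f ^ 2 with hNdef
    have hNN : (N : Ω) = (e : Ω) ^ 2 + d * f ^ 2 := by rw [hNdef]; push_cast; ring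
    have hNΩ : (N : Ω) ≠ 0 := by exact_mod_cast hN
    obtain ⟨X, Y, hXY⟩ := hF1 ((a * e + d * b * f) / N) ((b * e - a * f) / N)
      ((a' * e + d * b' * f) / N) ((b' * e - a' * f) / N)
    refine ⟨X, Y, ?_⟩
    have hc : R z' = R z * (((((a * e + d * b * f) / N : ℚ) : Ω) + ((b * e - a * f) / N : ℚ) * s) + 
        (((a' * e + d * b' * f) / N : ℚ) + ((b' * e - a' * f) / N : ℚ) * s) * Δ) := by
      apply mul_right_cancel₀ h0'
      rw [hp]
      push_cast
      rw [mul_right_comm, hef]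
      field_simp
      rw [hNN]
      linear_combination (a * f ^ 2 - b * e * f + (a' * f ^ 2 - b' * e * f) * Δ) * hs
    have hτc := congrArg τ hc
    simp only [map_mul, map_add, hτs, hτΔ, map_ratCast] at hτc
    rw [hβ, hβ, ← hXY, hτc]
    conv_lhs => rw [hc]
    ring
  · intro P hP h2
    obtain ⟨z, hz⟩ := hprime P hP h2
    refine ⟨z, fun h => hz (γ z) (hγ z) (hP.mem_of_pow_mem _ h)⟩
  · intro z
    obtain ⟨A, B, A', B', h1, h2⟩ := hcub z
    obtain ⟨e, f, hef⟩ := hnorm z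
    obtain ⟨X, t, h3, h4⟩ := hF2 A B A' B'
    have h1τ := congrArg τ h1
    have h2τ := congrArg τ h2
    simp only [map_mul, map_add, map_sub, map_pow, hτs, hτΔ, map_intCast, map_ofNat] at h1τ h2τ
    have hefτ := congrArg τ hef
    simp only [map_mul, map_add, hτs, map_ratCast] at hefτ
    have hb : 64 * (R z ^ 3 * τ (R z) ^ 3) = X + 12 * t * r := by
      rw [← h3]
      linear_combination (8 * τ (R z) ^ 3) * h1 + (2 * (A + B * s) + 3 * (A' + B' * s) * Δ) * h1τ
    have hb' : 64 * (R' z ^ 3 * τ (R' z) ^ 3) = X - 12 * t * r := by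
      rw [← h4]
      linear_combination (8 * τ (R' z) ^ 3) * h2 + (2 * (A + B * s) - 3 * (A' + B' * s) * Δ) * h2τ
    refine ⟨X / 64, 3 * t / 16, ?_, ⟨e ^ 2 + d * f ^ 2, ?_⟩, t, by ring⟩
    · simp only [hβ]
      push_cast
      linear_combination (1/64) * hb
    · have : (((X / 64) ^ 2 - D * (3 * t / 16) ^ 2 : ℚ) : Ω) = (((e ^ 2 + d * f ^ 2) ^ 3 : ℚ) : Ω) := by
        push_cast
        have e1 : (X / 64 : Ω) ^ 2 - D * (3 * t / 16) ^ 2 = 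
            (R z ^ 3 * τ (R z) ^ 3) * (R' z ^ 3 * τ (R' z) ^ 3) := by
          rw [← hr]
          linear_combination (-1/64^2) * (X - 12 * t * r) * hb - (1/64) * (R z ^ 3 * τ (R z) ^ 3) * hb'
        rw [e1]
        have e2 : (R z ^ 3 * τ (R z) ^ 3) * (R' z ^ 3 * τ (R' z) ^ 3) = 
          ((R z * R' z) * (τ (R z) * τ (R' z))) ^ 3 := by ring
        rw [e2, hef, hefτ]
        congr 1
        linear_combination (-(f : Ω) ^ 2) * hs
      exact_mod_cast this


theorem form_plus {Ω : Type*} [Field Ω] [CharZero Ω] (s Δ : Ω) (d : ℕ) (hs : s ^ 2 = -(d : Ω))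
    (δ : ℤ) (hΔ : Δ ^ 2 = (δ : Ω)) :
    (∀ a b a' b' : ℚ, ∃ X Y : ℚ,
      ((a + b * s) + (a' + b' * s) * Δ) * ((a - b * s) + (a' - b' * s) * ((1 : Ω) * Δ)) = X + Y * Δ) ∧
    (∀ A B A' B' : ℤ, ∃ X : ℚ, ∃ t : ℤ,
      (2 * (A + B * s) + 3 * (A' + B' * s) * Δ) * (2 * (A - B * s) + 3 * (A' - B' * s) * ((1 : Ω) * Δ))
        = X + 12 * t * Δ ∧
      (2 * (A + B * s) - 3 * (A' + B' * s) * Δ) * (2 * (A - B * s) - 3 * (A' - B' * s) * ((1 : Ω) * Δ))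
        = X - 12 * t * Δ) := by
  constructor
  · intro a b a' b'
    refine ⟨a ^ 2 + d * b ^ 2 + δ * (a' ^ 2 + d * b' ^ 2), 2 * (a * a' + d * b * b'), ?_⟩
    push_cast
    linear_combination (-(b : Ω) ^ 2 - b' ^ 2 * Δ ^ 2 - 2 * b * b' * Δ) * hs + ((a' : Ω) ^ 2 + d * b' ^ 2) * hΔ
  · intro A B A' B'
    refine ⟨4 * (A ^ 2 + d * B ^ 2) + 9 * δ * (A' ^ 2 + d * B' ^ 2), A * A' + d * B * B', ?_, ?_⟩ <;> push_cast
    · linear_combination (-4 * (B : Ω) ^ 2 - 9 * B' ^ 2 * Δ ^ 2 - 12 * B * B' * Δ) * hs + 9 * ((A' : Ω) ^ 2 + d * B' ^ 2) * hΔ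
    · linear_combination (-4 * (B : Ω) ^ 2 - 9 * B' ^ 2 * Δ ^ 2 + 12 * B * B' * Δ) * hs + 9 * ((A' : Ω) ^ 2 + d * B' ^ 2) * hΔ

theorem form_minus {Ω : Type*} [Field Ω] [CharZero Ω] (s Δ : Ω) (d : ℕ) (hs : s ^ 2 = -(d : Ω))
    (δ : ℤ) (hΔ : Δ ^ 2 = (δ : Ω)) (r : Ω) (m : ℤ) (hr : s * Δ = m * r) :
    (∀ a b a' b' : ℚ, ∃ X Y : ℚ,
      ((a + b * s) + (a' + b' * s) * Δ) * ((a - b * s) + (a' - b' * s) * ((-1 : Ω) * Δ)) = X + Y * r) ∧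
    (∀ A B A' B' : ℤ, ∃ X : ℚ, ∃ t : ℤ,
      (2 * (A + B * s) + 3 * (A' + B' * s) * Δ) * (2 * (A - B * s) + 3 * (A' - B' * s) * ((-1 : Ω) * Δ))
        = X + 12 * t * r ∧
      (2 * (A + B * s) - 3 * (A' + B' * s) * Δ) * (2 * (A - B * s) - 3 * (A' - B' * s) * ((-1 : Ω) * Δ))
        = X - 12 * t * r) := by
  constructor
  · intro a b a' b'
    refine ⟨a ^ 2 + d * b ^ 2 - δ * (a' ^ 2 + d * b' ^ 2), 2 * m * (a * b' - a' * b), ?_⟩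
    push_cast
    linear_combination (-(b : Ω) ^ 2 + b' ^ 2 * Δ ^ 2) * hs - ((a' : Ω) ^ 2 + d * b' ^ 2) * hΔ + 2 * (a * b' - a' * b) * hr
  · intro A B A' B'
    refine ⟨4 * (A ^ 2 + d * B ^ 2) - 9 * δ * (A' ^ 2 + d * B' ^ 2), m * (A * B' - A' * B), ?_, ?_⟩ <;> push_cast
    · linear_combination (-4 * (B : Ω) ^ 2 + 9 * B' ^ 2 * Δ ^ 2) * hs - 9 * ((A' : Ω) ^ 2 + d * B' ^ 2) * hΔ + 12 * (A * B' - A' * B) * hr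
    · linear_combination (-4 * (B : Ω) ^ 2 + 9 * B' ^ 2 * Δ ^ 2) * hs - 9 * ((A' : Ω) ^ 2 + d * B' ^ 2) * hΔ - 12 * (A * B' - A' * B) * hr

theorem D_cases (d : ℕ) (hd : d ∈ ({1, 2, 3, 7, 11, 19, 43, 67, 163} : Finset ℕ)) (δ : ℤ)
    (h : (d = 1 ∧ δ = 6) ∨ (d ≠ 1 ∧ δ = 3)) :
    δ ∈ ({3, 6, -1, -6, -21, -33, -57, -129, -201, -489} : Finset ℤ) ∧
    ∃ m D : ℤ, m ≠ 0 ∧ D ∈ ({3, 6, -1, -6, -21, -33, -57, -129, -201, -489} : Finset ℤ) ∧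
      m ^ 2 * D = -(d : ℤ) * δ := by
  simp only [Finset.mem_insert, Finset.mem_singleton] at hd
  rcases h with ⟨h1, h2⟩ | ⟨h1, h2⟩
  · subst h1 h2
    exact ⟨by decide, 1, -6, by decide, by decide, by norm_num⟩
  · subst h2
    refine ⟨by decide, ?_⟩
    rcases hd with h | h | h | h | h | h | h | h | h <;> subst h
    · exact absurd rfl h1
    · exact ⟨1, -6, by decide, by decide, by norm_num⟩
    · exact ⟨3, -1, by decide, by decide, by norm_num⟩
    · exact ⟨1, -21, by decide, by decide, by norm_num⟩
    · exact ⟨1, -33, by decide, by decide, by norm_num⟩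
    · exact ⟨1, -57, by decide, by decide, by norm_num⟩
    · exact ⟨1, -129, by decide, by decide, by norm_num⟩
    · exact ⟨1, -201, by decide, by decide, by norm_num⟩
    · exact ⟨1, -489, by decide, by decide, by norm_num⟩

theorem gal_fixed_int {K L : Type} [Field K] [NumberField K] [Field L] [NumberField L] [Algebra K L]
    [IsGalois K L] (σ ρ : L ≃ₐ[K] L)
    (hb : Function.Surjective (fun p : Fin 3 × Fin 2 => σ ^ (p.1 : ℕ) * ρ ^ (p.2 : ℕ)))
    (a : L) (hi : IsIntegral ℤ a) (h1 : σ a = a) (h2 : ρ a = a) :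
    ∃ b : 𝓞 K, algebraMap K L (b : K) = a := by
  obtain ⟨b, hb⟩ := gal_fixed σ ρ hb a h1 h2
  have : IsIntegral ℤ b := by
    rw [← hb] at hi
    exact (isIntegral_algebraMap_iff (algebraMap K L).injective).mp hi
  exact ⟨⟨b, this⟩, hb⟩

theorem R_cub_aux {K L : Type} [Field K] [NumberField K] [Field L] [NumberField L] [Algebra K L]
    [IsGalois K L] (σ ρ : L ≃ₐ[K] L)
    (hb : Function.Surjective (fun p : Fin 3 × Fin 2 => σ ^ (p.1 : ℕ) * ρ ^ (p.2 : ℕ)))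
    (ε : (𝓞 K)ˣ) (y : L) (hy : y ^ 2 = algebraMap K L ((ε : 𝓞 K) : K)) (hσy : σ y = y) (hρy : ρ y = -y)
    (x1 x2 x3 : L) (hi1 : IsIntegral ℤ x1) (hi2 : IsIntegral ℤ x2) (hi3 : IsIntegral ℤ x3)
    (h1 : σ x1 = x2) (h2 : σ x2 = x3) (h3 : σ x3 = x1)
    (h4 : ρ x1 = x1) (h5 : ρ x2 = x3) (h6 : ρ x3 = x2) :
    ∃ G v : 𝓞 K, algebraMap K L (G : K) = 2 * (x1 ^ 3 + x2 ^ 3 + x3 ^ 3 + 6 * x1 * x2 * x3) -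
      3 * ((x1 ^ 2 * x2 + x2 ^ 2 * x3 + x3 ^ 2 * x1) + (x1 * x2 ^ 2 + x2 * x3 ^ 2 + x3 * x1 ^ 2)) ∧
      algebraMap K L (v : K) * y = 
        (x1 ^ 2 * x2 + x2 ^ 2 * x3 + x3 ^ 2 * x1) - (x1 * x2 ^ 2 + x2 * x3 ^ 2 + x3 * x1 ^ 2) := by
  have hn : ∀ n : ℕ, IsIntegral ℤ (n : L) := fun n => by
    simpa using isIntegral_algebraMap (R := ℤ) (A := L) (x := (n : ℤ))
  have hn2 : IsIntegral ℤ (2 : L) := by simpa using hn 2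
  have hn3 : IsIntegral ℤ (3 : L) := by simpa using hn 3
  have hn6 : IsIntegral ℤ (6 : L) := by simpa using hn 6
  have hAi : IsIntegral ℤ (x1 ^ 2 * x2 + x2 ^ 2 * x3 + x3 ^ 2 * x1) :=
    (((hi1.pow 2).mul hi2).add ((hi2.pow 2).mul hi3)).add ((hi3.pow 2).mul hi1)
  have hBi : IsIntegral ℤ (x1 * x2 ^ 2 + x2 * x3 ^ 2 + x3 * x1 ^ 2) :=
    ((hi1.mul (hi2.pow 2)).add (hi2.mul (hi3.pow 2))).add (hi3.mul (hi1.pow 2))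
  obtain ⟨G, hG⟩ := gal_fixed_int σ ρ hb (2 * (x1 ^ 3 + x2 ^ 3 + x3 ^ 3 + 6 * x1 * x2 * x3) -
      3 * ((x1 ^ 2 * x2 + x2 ^ 2 * x3 + x3 ^ 2 * x1) + (x1 * x2 ^ 2 + x2 * x3 ^ 2 + x3 * x1 ^ 2)))
    ((hn2.mul ((((hi1.pow 3).add (hi2.pow 3)).add (hi3.pow 3)).add (((hn6.mul hi1).mul hi2).mul hi3))).sub 
      (hn3.mul (hAi.add hBi)))
    (by simp only [map_sub, map_mul, map_add, map_pow, map_ofNat, h1, h2, h3]; ring)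
    (by simp only [map_sub, map_mul, map_add, map_pow, map_ofNat, h4, h5, h6]; ring)
  have hεi : algebraMap K L ((ε : 𝓞 K) : K) * algebraMap K L (((ε⁻¹ : (𝓞 K)ˣ) : 𝓞 K) : K) = 1 := by
    rw [← map_mul, ← map_mul, Units.mul_inv]; simp
  have hIε : IsIntegral ℤ (algebraMap K L (((ε⁻¹ : (𝓞 K)ˣ) : 𝓞 K) : K)) :=
    map_isIntegral_int (algebraMap K L) (RingOfIntegers.isIntegral_coe _)
  have hyi : IsIntegral ℤ y := by
    apply IsIntegral.of_pow (n := 2) (by norm_num)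
    rw [hy]
    exact map_isIntegral_int (algebraMap K L) (RingOfIntegers.isIntegral_coe _)
  obtain ⟨v, hv⟩ := gal_fixed_int σ ρ hb (((x1 ^ 2 * x2 + x2 ^ 2 * x3 + x3 ^ 2 * x1) - 
      (x1 * x2 ^ 2 + x2 * x3 ^ 2 + x3 * x1 ^ 2)) * y * algebraMap K L (((ε⁻¹ : (𝓞 K)ˣ) : 𝓞 K) : K))
    (((hAi.sub hBi).mul hyi).mul hIε)
    (by simp only [map_sub, map_mul, map_add, map_pow, map_ofNat, h1, h2, h3, hσy, AlgEquiv.commutes]; ring)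
    (by simp only [map_sub, map_mul, map_add, map_pow, map_ofNat, h4, h5, h6, hρy, AlgEquiv.commutes]; ring)
  refine ⟨G, v, hG, ?_⟩
  rw [hv]
  set e := algebraMap K L (((ε⁻¹ : (𝓞 K)ˣ) : 𝓞 K) : K)
  rw [← hy] at hεi
  linear_combination ((x1 ^ 2 * x2 + x2 ^ 2 * x3 + x3 ^ 2 * x1) - (x1 * x2 ^ 2 + x2 * x3 ^ 2 + x3 * x1 ^ 2)) * hεi

/-- algebra of the Lagrange resolvent -/
theorem R_cub_alg {Ω : Type*} [Field Ω] [CharZero Ω] (ω x1 x2 x3 G v y μ Δ : Ω)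
    (hω : ω ^ 2 + ω + 1 = 0) 
    (hG : G = 2 * (x1 ^ 3 + x2 ^ 3 + x3 ^ 3 + 6 * x1 * x2 * x3) -
      3 * ((x1 ^ 2 * x2 + x2 ^ 2 * x3 + x3 ^ 2 * x1) + (x1 * x2 ^ 2 + x2 * x3 ^ 2 + x3 * x1 ^ 2)))
    (hv : v * y = 
        (x1 ^ 2 * x2 + x2 ^ 2 * x3 + x3 ^ 2 * x1) - (x1 * x2 ^ 2 + x2 * x3 ^ 2 + x3 * x1 ^ 2))
    (hΔ : μ * Δ = 2 * (2 * ω + 1) * y) :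
    4 * (x1 + ω * x2 + ω ^ 2 * x3) ^ 3 = 2 * G + 3 * (v * μ) * Δ ∧
    4 * (x1 + ω ^ 2 * x2 + ω * x3) ^ 3 = 2 * G - 3 * (v * μ) * Δ := by
  have h2 : ω ^ 2 = -1 - ω := by linear_combination hω
  have h3 : ω ^ 3 = 1 := by linear_combination (ω - 1) * hω
  have e : 3 * (v * μ) * Δ = 6 * (2 * ω + 1) * ((x1 ^ 2 * x2 + x2 ^ 2 * x3 + x3 ^ 2 * x1) - (x1 * x2 ^ 2 + x2 * x3 ^ 2 + x3 * x1 ^ 2)) := by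
    linear_combination 3 * v * hΔ + 6 * (2 * ω + 1) * hv
  have e1 : (x1 + ω * x2 + ω ^ 2 * x3) ^ 3 = x1 ^ 3 + ω ^ 3 * x2 ^ 3 + (ω ^ 3) ^ 2 * x3 ^ 3 + 6 * ω ^ 3 * x1 * x2 * x3
    + 3 * ω * (x1 ^ 2 * x2) + 3 * ω ^ 3 * ω * (x2 ^ 2 * x3) + 3 * ω ^ 3 * ω * (x3 ^ 2 * x1)
    + 3 * ω ^ 2 * (x1 * x2 ^ 2) + 3 * ω ^ 3 * ω ^ 2 * (x2 * x3 ^ 2) + 3 * ω ^ 2 * (x3 * x1 ^ 2) := by ring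
  have e2 : (x1 + ω ^ 2 * x2 + ω * x3) ^ 3 = x1 ^ 3 + ω ^ 3 * x3 ^ 3 + (ω ^ 3) ^ 2 * x2 ^ 3 + 6 * ω ^ 3 * x1 * x2 * x3
    + 3 * ω * (x1 ^ 2 * x3) + 3 * ω ^ 3 * ω * (x3 ^ 2 * x2) + 3 * ω ^ 3 * ω * (x2 ^ 2 * x1)
    + 3 * ω ^ 2 * (x1 * x3 ^ 2) + 3 * ω ^ 3 * ω ^ 2 * (x3 * x2 ^ 2) + 3 * ω ^ 2 * (x2 * x1 ^ 2) := by ring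
  rw [e, e1, e2, h3, h2, hG]
  constructor <;> ring

theorem R_prod_alg {Ω : Type*} [Field Ω] [CharZero Ω] (ω x1 x2 x3 u1 u2 u3 : Ω)
    (hω : ω ^ 2 + ω + 1 = 0) :
    (x1 + ω * x2 + ω ^ 2 * x3) * (u1 + ω ^ 2 * u2 + ω * u3) = 
      (x1 * u1 + x2 * u2 + x3 * u3) - ((x1 * u3 + x2 * u1 + x3 * u2) + (x1 * u2 + x2 * u3 + x3 * u1)) / 2
      + (2 * ω + 1) * ((x1 * u3 + x2 * u1 + x3 * u2) - (x1 * u2 + x2 * u3 + x3 * u1)) / 2 := by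
  have h2 : ω ^ 2 = -1 - ω := by linear_combination hω
  have h3 : ω ^ 3 = 1 := by linear_combination (ω - 1) * hω
  have e : (x1 + ω * x2 + ω ^ 2 * x3) * (u1 + ω ^ 2 * u2 + ω * u3) = 
    x1 * u1 + ω ^ 3 * x2 * u2 + ω ^ 3 * x3 * u3 + ω * (x1 * u3 + x2 * u1 + ω ^ 3 * x3 * u2) + 
      ω ^ 2 * (x1 * u2 + x2 * u3 + x3 * u1) := by ring
  rw [e, h3, h2]; ring


theorem hom_nonvanish2 {K L : Type} [Field K] [NumberField K] [Field L] [NumberField L] [Algebra K L]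
    [IsGalois K L]
    (hunr : ∀ P : Ideal (𝓞 K), P.IsPrime → P ≠ ⊥ → (2 : 𝓞 K) ∉ P →
      ∀ Q : Ideal (𝓞 L), Q.IsPrime → Q.comap (algebraMap (𝓞 K) (𝓞 L)) = P →
        Ideal.ramificationIdx' P Q = 1)
    (σ ρ : L ≃ₐ[K] L)
    (hb : Function.Injective (fun p : Fin 3 × Fin 2 => σ ^ (p.1 : ℕ) * ρ ^ (p.2 : ℕ)))
    {T : Type*} [CommRing T] [IsDomain T] (f g : 𝓞 L →+* T) (h2 : (2 : T) ≠ 0) (w w' : T) :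
    ∃ z : 𝓞 L, f (z + ρ • z) + w * f (σ • (z + ρ • z)) + w ^ 2 * f (σ • σ • (z + ρ • z)) ≠ 0 ∧
      g (z + ρ • z) + w' * g (σ • (z + ρ • z)) + w' ^ 2 * g (σ • σ • (z + ρ • z)) ≠ 0 := by
  obtain ⟨z1, h1⟩ := hom_nonvanish hunr σ ρ hb f h2 w
  obtain ⟨z2, h2⟩ := hom_nonvanish hunr σ ρ hb g h2 w'
  by_cases h3 : g (z1 + ρ • z1) + w' * g (σ • (z1 + ρ • z1)) + w' ^ 2 * g (σ • σ • (z1 + ρ • z1)) = 0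
  swap
  · exact ⟨z1, h1, h3⟩
  by_cases h4 : f (z2 + ρ • z2) + w * f (σ • (z2 + ρ • z2)) + w ^ 2 * f (σ • σ • (z2 + ρ • z2)) = 0
  swap
  · exact ⟨z2, h4, h2⟩
  refine ⟨z1 + z2, ?_, ?_⟩
  · intro h
    apply h1
    simp only [smul_add, map_add] at h h4 ⊢
    linear_combination h - h4
  · intro h
    apply h2
    simp only [smul_add, map_add] at h h3 ⊢
    linear_combination h - h3

theorem hprime_aux {K L : Type} [Field K] [NumberField K] [Field L] [NumberField L] [Algebra K L]
    [IsGalois K L]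
    (hunr : ∀ P : Ideal (𝓞 K), P.IsPrime → P ≠ ⊥ → (2 : 𝓞 K) ∉ P →
      ∀ Q : Ideal (𝓞 L), Q.IsPrime → Q.comap (algebraMap (𝓞 K) (𝓞 L)) = P →
        Ideal.ramificationIdx' P Q = 1)
    (σ ρ : L ≃ₐ[K] L)
    (hb : Function.Injective (fun p : Fin 3 × Fin 2 => σ ^ (p.1 : ℕ) * ρ ^ (p.2 : ℕ)))
    {Ω : Type*} [Field Ω] [CharZero Ω] (ι : 𝓞 L →+* Ω) (ω : Ω) (hω : IsIntegral ℤ ω) (τ : Ω →+* Ω)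
    (P : Ideal (integralClosure ℤ Ω)) (hP : P.IsPrime) (h2 : (2 : integralClosure ℤ Ω) ∉ P) :
    ∃ z : 𝓞 L, ∀ x : integralClosure ℤ Ω, (x : Ω) = 
      (ι (z + ρ • z) + ω * ι (σ • (z + ρ • z)) + ω ^ 2 * ι (σ • σ • (z + ρ • z))) *
      τ (ι (z + ρ • z) + ω * ι (σ • (z + ρ • z)) + ω ^ 2 * ι (σ • σ • (z + ρ • z))) → x ∉ P := by
  have h_integral : ∀ (g : 𝓞 L →+* Ω) z, g z ∈ integralClosure ℤ Ω := fun g z =>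
    map_isIntegral_int g (by
      have := RingOfIntegers.isIntegral_coe z
      exact (isIntegral_algebraMap_iff (B := L) RingOfIntegers.coe_injective).mp this)
  let f : 𝓞 L →+* integralClosure ℤ Ω := ι.codRestrict (integralClosure ℤ Ω) (h_integral ι)
  let g : 𝓞 L →+* integralClosure ℤ Ω := (τ.comp ι).codRestrict (integralClosure ℤ Ω) (h_integral _)
  let w : integralClosure ℤ Ω := ⟨ω, hω⟩
  let w' : integralClosure ℤ Ω := ⟨τ ω, map_isIntegral_int τ hω⟩
  let m := Ideal.Quotient.mk P
  have hdom : IsDomain (integralClosure ℤ Ω ⧸ P) := (Ideal.Quotient.isDomain_iff_prime P).mpr hP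
  have h2' : (2 : integralClosure ℤ Ω ⧸ P) ≠ 0 := by
    intro h
    apply h2
    rw [← Ideal.Quotient.eq_zero_iff_mem, map_ofNat]
    exact h
  obtain ⟨z, hz1, hz2⟩ := hom_nonvanish2 hunr σ ρ hb (m.comp f) (m.comp g) h2' (m w) (m w')
  refine ⟨z, fun x hx hxP => ?_⟩
  have e : x = (f (z + ρ • z) + w * f (σ • (z + ρ • z)) + w ^ 2 * f (σ • σ • (z + ρ • z))) *
      (g (z + ρ • z) + w' * g (σ • (z + ρ • z)) + w' ^ 2 * g (σ • σ • (z + ρ • z))) := by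
    apply Subtype.ext
    rw [hx, map_add τ, map_add τ, map_mul τ, map_mul τ, map_pow τ]
    rfl
  rw [← Ideal.Quotient.eq_zero_iff_mem, e, map_mul] at hxP
  rcases mul_eq_zero.mp hxP with h | h
  · apply hz1
    simp only [RingHom.comp_apply]
    rw [← h]; simp only [map_add, map_mul, map_pow]; rfl
  · apply hz2
    simp only [RingHom.comp_apply]
    rw [← h]; simp only [map_add, map_mul, map_pow]; rfl

theorem exists_taus {K Ω : Type} [Field K] [NumberField K] [Field Ω] [CharZero Ω] [Algebra K Ω]
    [Normal K Ω] [Normal ℚ Ω] (d : ℕ) (hd0 : d ≠ 0) (hdn : ∀ q : ℚ, q ^ 2 ≠ ((-(d : ℤ) : ℤ) : ℚ))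
    (s : K) (hs : s ^ 2 = -(d : K)) (hK : Module.finrank ℚ K = 2)
    (δ : ℤ) (hδ : 0 < δ) (hδn : ∀ q : ℚ, q ^ 2 ≠ δ) (Δ : Ω) (hΔ : Δ ^ 2 = (δ : Ω)) :
    (∃ κ : Ω ≃ₐ[K] Ω, κ Δ = -Δ) ∧
    (∃ τ : Ω →+* Ω, τ (algebraMap K Ω s) = -algebraMap K Ω s ∧ τ Δ = Δ) ∧
    (∃ τ : Ω →+* Ω, τ (algebraMap K Ω s) = -algebraMap K Ω s ∧ τ Δ = -Δ) := by
  have hs' : s ^ 2 = ((-(d : ℤ) : ℤ) : K) := by rw [hs]; push_cast; ring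
  have hnsq : ∀ x : K, x ^ 2 ≠ (δ : K) := by
    intro x hx
    obtain ⟨a, b, rfl⟩ := quad_repr (-(d : ℤ)) hdn s hs' hK x
    have h1 : ((a ^ 2 - d * b ^ 2 : ℚ) : K) + ((2 * a * b : ℚ) : K) * s = ((δ : ℚ) : K) + ((0 : ℚ) : K) * s := by
      push_cast
      linear_combination hx - (b : K) ^ 2 * hs
    obtain ⟨h2, h3⟩ := quad_unique (-(d : ℤ)) hdn s hs' h1
    have hδ' : (0 : ℚ) < δ := by exact_mod_cast hδ
    rcases mul_eq_zero.mp h3 with h | h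
    · have ha : a = 0 := by linarith
      rw [ha] at h2
      have : (0 : ℚ) ≤ d * b ^ 2 := by positivity
      linarith
    · rw [h] at h2
      exact hδn a (by linarith)
  obtain ⟨κ, hκ⟩ := exists_conj (δ : K) hnsq Δ (by rw [hΔ]; simp)
  obtain ⟨τ, hτ⟩ := exists_conj (F := ℚ) (Ω := Ω) _ hdn (algebraMap K Ω s) (by
    rw [← map_pow, hs]; simp)
  have hκs : κ (algebraMap K Ω s) = algebraMap K Ω s := κ.commutes s
  have hτΔ : τ Δ = Δ ∨ τ Δ = -Δ := by
    apply sq_eq_sq_iff_eq_or_eq_neg.mp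
    rw [← map_pow, hΔ]; simp
  refine ⟨⟨κ, hκ⟩, ?_⟩
  let t1 : Ω →+* Ω := (τ : Ω →+* Ω)
  let t2 : Ω →+* Ω := (κ : Ω →+* Ω).comp (τ : Ω →+* Ω)
  have a1 : t1 (algebraMap K Ω s) = -algebraMap K Ω s := hτ
  have a2 : t2 (algebraMap K Ω s) = -algebraMap K Ω s := by
    change κ (τ _) = _
    rw [hτ, map_neg, hκs]
  rcases hτΔ with h | h
  · exact ⟨⟨t1, a1, h⟩, ⟨t2, a2, by change κ (τ _) = _; rw [h, hκ]⟩⟩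
  · exact ⟨⟨t2, a2, by change κ (τ _) = _; rw [h, map_neg, hκ, neg_neg]⟩, ⟨t1, a1, h⟩⟩

theorem two_mul_int {K Ω : Type} [Field K] [NumberField K] [Field Ω] [CharZero Ω] [Algebra K Ω]
    (d : ℕ) (hsqf : Squarefree (-(d : ℤ))) (hdn : ∀ q : ℚ, q ^ 2 ≠ ((-(d : ℤ) : ℤ) : ℚ))
    (s : K) (hs : s ^ 2 = -(d : K)) (hK : Module.finrank ℚ K = 2)
    (τ : Ω →+* Ω) (hτ : τ (algebraMap K Ω s) = -algebraMap K Ω s) (G : 𝓞 K) :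
    ∃ A B : ℤ, 2 * algebraMap K Ω (G : K) = A + B * algebraMap K Ω s := by
  have hs' : s ^ 2 = ((-(d : ℤ) : ℤ) : K) := by rw [hs]; push_cast; ring
  obtain ⟨a, b, hab⟩ := quad_repr (-(d : ℤ)) hdn s hs' hK (G : K)
  have hG : IsIntegral ℤ (algebraMap K Ω (G : K)) := 
    map_isIntegral_int (algebraMap K Ω) (RingOfIntegers.isIntegral_coe _)
  have hG' := map_isIntegral_int τ hG
  have e : algebraMap K Ω (G : K) = a + b * algebraMap K Ω s := by rw [hab]; simp
  rw [e] at hG hG' ⊢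
  simp only [map_add, map_mul, map_ratCast, hτ] at hG'
  obtain ⟨A, B, -, hA, hB, -⟩ := quad_integral2 (-(d : ℤ)) hsqf (algebraMap K Ω s) (by
    rw [← map_pow, hs']; simp) a b hG (by rwa [mul_neg, ← sub_eq_add_neg] at hG')
  refine ⟨A, B, ?_⟩
  have hA' : ((2 * a : ℚ) : Ω) = ((A : ℚ) : Ω) := by rw [hA]
  have hB' : ((2 * b : ℚ) : Ω) = ((B : ℚ) : Ω) := by rw [hB]
  push_cast at hA' hB'
  linear_combination hA' + algebraMap K Ω s * hB'


theorem main_contra (d : ℕ) (hd : d ∈ ({1, 2, 3, 7, 11, 19, 43, 67, 163} : Finset ℕ))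
    {K L Ω : Type} [Field K] [NumberField K]
    (s : K) (hs : s ^ 2 = -(d : K)) (hK : Module.finrank ℚ K = 2)
    (ε : (𝓞 K)ˣ) [Field L] [Algebra K L] [NumberField L] [IsGalois K L]
    (hunr : ∀ P : Ideal (𝓞 K), P.IsPrime → P ≠ ⊥ → (2 : 𝓞 K) ∉ P →
      ∀ Q : Ideal (𝓞 L), Q.IsPrime → Q.comap (algebraMap (𝓞 K) (𝓞 L)) = P →
        Ideal.ramificationIdx' P Q = 1)
    [Field Ω] [CharZero Ω] [Algebra K Ω] [Algebra L Ω] [IsScalarTower K L Ω] [IsAlgClosed Ω]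
    [Normal K Ω] [Normal ℚ Ω]
    (σ ρ : L ≃ₐ[K] L) (hσ3 : σ ^ 3 = 1) (hρ2 : ρ ^ 2 = 1) (hρσ : ρ * σ = σ ^ 2 * ρ)
    (hb : Function.Bijective (fun p : Fin 3 × Fin 2 => σ ^ (p.1 : ℕ) * ρ ^ (p.2 : ℕ)))
    (y : L) (hy : y ^ 2 = algebraMap K L ((ε : 𝓞 K) : K)) (hσy : σ y = y) (hρy : ρ y = -y)
    (δ : ℤ) (μ : 𝓞 K) (hμ0 : μ ≠ 0) (hμ : -12 * ((ε : 𝓞 K) : K) = (μ : K) ^ 2 * δ)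
    (hδ : (d = 1 ∧ δ = 6) ∨ (d ≠ 1 ∧ δ = 3)) : False := by
  obtain ⟨hsqf, hdn⟩ := d_facts d hd
  have hd0 : d ≠ 0 := by rintro rfl; revert hd; decide
  have hs' : s ^ 2 = ((-(d : ℤ) : ℤ) : K) := by rw [hs]; push_cast; ring
  obtain ⟨hδD, m, D, hm0, hDD, hmD⟩ := D_cases d hd δ hδ
  have hδpos : 0 < δ := by omega
  have hδn := nonsq_of_squarefree δ (D_facts δ hδD).1 (by omega)
  -- roots in Ω
  obtain ⟨q, hq⟩ := IsAlgClosed.exists_pow_nat_eq (-3 : Ω) (n := 2) (by norm_num)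
  obtain ⟨ω, hωq⟩ : ∃ ω : Ω, 2 * ω + 1 = q := ⟨(q - 1) / 2, by ring⟩
  have hω : ω ^ 2 + ω + 1 = 0 := by
    have h4 : (4 : Ω) ≠ 0 := by norm_num
    apply mul_left_cancel₀ h4
    rw [← hωq] at hq
    linear_combination hq
  have hω3 : ω ^ 3 = 1 := by linear_combination (ω - 1) * hω
  have hωint : IsIntegral ℤ ω := by
    apply IsIntegral.of_pow (n := 3) (by norm_num)
    rw [hω3]; exact isIntegral_one
  have hω0 : ω ≠ 0 := by rintro rfl; norm_num at hω
  have hω1 : ω ^ 2 ≠ 1 := by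
    intro h
    have h1 : ω = -2 := by linear_combination hω - h
    rw [h1] at h; norm_num at h
  let k := algebraMap K Ω
  let ι := algebraMap L Ω
  have hkι : ∀ x : K, ι (algebraMap K L x) = k x := fun x => (IsScalarTower.algebraMap_apply K L Ω x).symm
  have hkμ : k (μ : K) ≠ 0 := by
    rw [map_ne_zero]
    intro h
    exact hμ0 (RingOfIntegers.ext h)
  obtain ⟨Δ, hΔμ⟩ : ∃ Δ : Ω, k (μ : K) * Δ = 2 * (2 * ω + 1) * ι y :=
    ⟨2 * (2 * ω + 1) * ι y / k (μ : K), by field_simp⟩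
  have hιy : (ι y) ^ 2 = k ((ε : 𝓞 K) : K) := by rw [← map_pow, hy, hkι]
  have hkε : -12 * k ((ε : 𝓞 K) : K) = k (μ : K) ^ 2 * δ := by
    have := congrArg k hμ
    rw [map_mul, map_mul, map_neg, map_ofNat, map_pow, map_intCast] at this
    exact this
  have hΔ2 : Δ ^ 2 = (δ : Ω) := by
    apply mul_left_cancel₀ (pow_ne_zero 2 hkμ)
    rw [← mul_pow, hΔμ, ← hkε, ← hιy, hωq]
    linear_combination 4 * (ι y) ^ 2 * hq
  have hy0 : y ≠ 0 := by
    rintro rfl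
    have h : ((ε : 𝓞 K) : K) = 0 := by
      have : algebraMap K L ((ε : 𝓞 K) : K) = 0 := by rw [← hy]; ring
      exact (map_eq_zero _).mp this
    have h2 : (ε : 𝓞 K) = 0 := RingOfIntegers.ext h
    exact ε.ne_zero h2
  obtain ⟨⟨κ, hκ⟩, ⟨τp, hτps, hτpΔ⟩, ⟨τm, hτms, hτmΔ⟩⟩ := exists_taus (Ω := Ω) d hd0 hdn s hs hK δ hδpos hδn Δ hΔ2
  have hks : (k s) ^ 2 = -(d : Ω) := by rw [← map_pow, hs]; simp
  have hrep : ∀ x : K, ∃ a b : ℚ, k x = a + b * k s := by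
    intro x
    obtain ⟨a, b, hab⟩ := quad_repr (-(d : ℤ)) hdn s hs' hK x
    refine ⟨a, b, ?_⟩
    rw [hab]; simp
  -- resolvents
  let ι0 : 𝓞 L →+* Ω := ι.comp (algebraMap (𝓞 L) L)
  let x1 : 𝓞 L → L := fun z => ((z + ρ • z : 𝓞 L) : L)
  let x2 : 𝓞 L → L := fun z => σ (x1 z)
  let x3 : 𝓞 L → L := fun z => σ (x2 z)
  let R : 𝓞 L → Ω := fun z => ι (x1 z) + ω * ι (x2 z) + ω ^ 2 * ι (x3 z)
  let R' : 𝓞 L → Ω := fun z => ι (x1 z) + ω ^ 2 * ι (x2 z) + ω * ι (x3 z)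
  have h1 : ∀ z, σ (x1 z) = x2 z := fun z => rfl
  have h2 : ∀ z, σ (x2 z) = x3 z := fun z => rfl
  have h3 : ∀ z, σ (x3 z) = x1 z := fun z => by
    change (σ ^ 3) (x1 z) = _
    rw [hσ3]; rfl
  have h4 : ∀ z, ρ (x1 z) = x1 z := fun z => by
    have e : x1 z = (z : L) + ρ (z : L) := rfl
    have e2 : ρ (ρ (z : L)) = (z : L) := by
      change (ρ ^ 2) (z : L) = _
      rw [hρ2]; rfl
    rw [e, map_add, e2, add_comm]
  have hρσ' : ∀ x, ρ (σ x) = σ (σ (ρ x)) := fun x => by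
    have := congrArg (fun f : L ≃ₐ[K] L => f x) hρσ
    exact this
  have h5 : ∀ z, ρ (x2 z) = x3 z := fun z => by
    change ρ (σ (x1 z)) = _
    rw [hρσ', h4]
  have h6 : ∀ z, ρ (x3 z) = x2 z := fun z => by
    change ρ (σ (x2 z)) = _
    rw [hρσ', h5, h3]
  have hi1 : ∀ z, IsIntegral ℤ (x1 z) := fun z => RingOfIntegers.isIntegral_coe _
  have hi2 : ∀ z, IsIntegral ℤ (x2 z) := fun z => map_isIntegral_int (σ : L →+* L) (hi1 z)
  have hi3 : ∀ z, IsIntegral ℤ (x3 z) := fun z => map_isIntegral_int (σ : L →+* L) (hi2 z)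
  have hRint : ∀ z, IsIntegral ℤ (R z) := fun z =>
    ((map_isIntegral_int ι (hi1 z)).add (hωint.mul (map_isIntegral_int ι (hi2 z)))).add
      ((hωint.pow 2).mul (map_isIntegral_int ι (hi3 z)))
  have hcubK : ∀ z, ∃ G w : 𝓞 K, 4 * R z ^ 3 = 2 * k (G : K) + 3 * k (w : K) * Δ ∧
      4 * R' z ^ 3 = 2 * k (G : K) - 3 * k (w : K) * Δ := by
    intro z
    obtain ⟨G, v, hG, hv⟩ := R_cub_aux σ ρ hb.2 ε y hy hσy hρy (x1 z) (x2 z) (x3 z) (hi1 z) (hi2 z) (hi3 z)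
      (h1 z) (h2 z) (h3 z) (h4 z) (h5 z) (h6 z)
    have hG' := congrArg ι hG
    have hv' := congrArg ι hv
    rw [hkι] at hG'
    rw [map_mul, hkι] at hv'
    simp only [map_sub, map_mul, map_add, map_pow, map_ofNat] at hG' hv'
    have := R_cub_alg ω (ι (x1 z)) (ι (x2 z)) (ι (x3 z)) (k (G : K)) (k (v : K)) (ι y) (k (μ : K)) Δ hω hG' hv' hΔμ
    refine ⟨G, v * μ, ?_⟩
    have e : k ((v * μ : 𝓞 K) : K) = k (v : K) * k (μ : K) := by rw [← map_mul]; rfl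
    rw [e]
    exact this
  have hcub : ∀ z, ∃ A B A' B' : ℤ, 8 * R z ^ 3 = 2 * (A + B * k s) + 3 * (A' + B' * k s) * Δ ∧
      8 * R' z ^ 3 = 2 * (A + B * k s) - 3 * (A' + B' * k s) * Δ := by
    intro z
    obtain ⟨G, w, e1, e2⟩ := hcubK z
    obtain ⟨A, B, hAB⟩ := two_mul_int (Ω := Ω) d hsqf hdn s hs hK τp hτps G
    obtain ⟨A', B', hAB'⟩ := two_mul_int (Ω := Ω) d hsqf hdn s hs hK τp hτps w
    refine ⟨A, B, A', B', ?_, ?_⟩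
    · rw [← hAB, ← hAB']; linear_combination 2 * e1
    · rw [← hAB, ← hAB']; linear_combination 2 * e2
  have hRR : ∀ z, R z ≠ 0 → R' z ≠ 0 := by
    intro z hz hz'
    obtain ⟨G, w, e1, e2⟩ := hcubK z
    rw [hz'] at e2
    have e3 := congrArg κ e2
    simp only [map_sub, map_mul, map_pow, map_ofNat, map_zero, hκ] at e3
    have hcm : ∀ x : K, κ (k x) = k x := fun x => κ.commutes x
    rw [hcm, hcm] at e3
    have : 4 * R z ^ 3 = 0 := by rw [e1]; linear_combination -e3
    have h40 : (4 : Ω) ≠ 0 := by norm_num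
    exact hz (pow_eq_zero_iff (by norm_num) |>.mp ((mul_eq_zero.mp this).resolve_left h40))
  have hprodK : ∀ z z', ∃ g u : K, R z * R' z' = k g + k u * Δ ∧ (z = z' → u = 0) := by
    intro z z'
    obtain ⟨g, hg⟩ := gal_fixed σ ρ hb.2 ((x1 z * x1 z' + x2 z * x2 z' + x3 z * x3 z') - 
      ((x1 z * x3 z' + x2 z * x1 z' + x3 z * x2 z') + (x1 z * x2 z' + x2 z * x3 z' + x3 z * x1 z')) / 2)
      (by simp only [map_sub, map_add, map_mul, map_div₀, map_ofNat, h1, h2, h3]; ring)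
      (by simp only [map_sub, map_add, map_mul, map_div₀, map_ofNat, h4, h5, h6]; ring)
    obtain ⟨u, hu⟩ := gal_fixed σ ρ hb.2 (((x1 z * x3 z' + x2 z * x1 z' + x3 z * x2 z') - 
      (x1 z * x2 z' + x2 z * x3 z' + x3 z * x1 z')) / y)
      (by simp only [map_sub, map_add, map_mul, map_div₀, h1, h2, h3, hσy]; ring)
      (by simp only [map_sub, map_add, map_mul, map_div₀, h4, h5, h6, hρy]; rw [div_neg]; ring)
    refine ⟨g, u * (μ : K) / 4, ?_, ?_⟩
    · have hg' := congrArg ι hg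
      have hu' : algebraMap K L u * y = (x1 z * x3 z' + x2 z * x1 z' + x3 z * x2 z') - 
        (x1 z * x2 z' + x2 z * x3 z' + x3 z * x1 z') := by rw [hu]; field_simp
      have hu' := congrArg ι hu'
      rw [hkι] at hg'
      rw [map_mul, hkι] at hu'
      simp only [map_sub, map_add, map_mul, map_div₀, map_ofNat] at hg' hu'
      change (ι (x1 z) + ω * ι (x2 z) + ω ^ 2 * ι (x3 z)) * (ι (x1 z') + ω ^ 2 * ι (x2 z') + ω * ι (x3 z')) = _
      rw [R_prod_alg ω _ _ _ _ _ _ hω, hg', ← hu', map_div₀, map_mul, map_ofNat]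
      linear_combination (-(k u) / 4) * hΔμ
    · rintro rfl
      have : algebraMap K L u = 0 := by
        rw [hu]
        have : (x1 z * x3 z + x2 z * x1 z + x3 z * x2 z) - 
          (x1 z * x2 z + x2 z * x3 z + x3 z * x1 z) = 0 := by ring
        rw [this, zero_div]
      rw [(map_eq_zero _).mp this]; simp
  have hprod : ∀ z z', ∃ a b a' b' : ℚ, R z * R' z' = (a + b * k s) + (a' + b' * k s) * Δ := by
    intro z z'
    obtain ⟨g, u, hgu, -⟩ := hprodK z z'
    obtain ⟨a, b, hab⟩ := hrep g
    obtain ⟨a', b', hab'⟩ := hrep u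
    exact ⟨a, b, a', b', by rw [hgu, hab, hab']⟩
  have hnorm : ∀ z, ∃ e f : ℚ, R z * R' z = e + f * k s := by
    intro z
    obtain ⟨g, u, hgu, hu⟩ := hprodK z z
    obtain ⟨a, b, hab⟩ := hrep g
    exact ⟨a, b, by rw [hgu, hu rfl, hab]; simp⟩
  have hprime : ∀ τ : Ω →+* Ω, ∀ P : Ideal (integralClosure ℤ Ω), P.IsPrime → (2 : integralClosure ℤ Ω) ∉ P → 
      ∃ z, ∀ x : integralClosure ℤ Ω, (x : Ω) = R z * τ (R z) → x ∉ P := by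
    intro τ P hP h2
    exact hprime_aux hunr σ ρ hb.1 ι0 ω hωint τ P hP h2
  obtain ⟨fp1, fp2⟩ := form_plus (k s) Δ d hks δ hΔ2
  have hmΩ : (m : Ω) ≠ 0 := by exact_mod_cast hm0
  obtain ⟨r, hr⟩ : ∃ r : Ω, k s * Δ = m * r := ⟨k s * Δ / m, by field_simp⟩
  have hr2 : r ^ 2 = (D : Ω) := by
    apply mul_left_cancel₀ (pow_ne_zero 2 hmΩ)
    have : ((m ^ 2 * D : ℤ) : Ω) = ((-(d : ℤ) * δ : ℤ) : Ω) := by rw [hmD]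
    push_cast at this
    rw [this, ← mul_pow, ← hr, mul_pow, hks, hΔ2]
  obtain ⟨fm1, fm2⟩ := form_minus (k s) Δ d hks δ hΔ2 r m hr
  have hplus := beta_cube δ hδD Δ (k s) Δ 1 hΔ2 d hd0 hks τp hτps (by rw [hτpΔ, one_mul]) fp1 fp2 R R'
    hRint hcub hnorm hRR hprod (hprime τp)
  have hminus := beta_cube D hDD r (k s) Δ (-1) hr2 d hd0 hks τm hτms (by rw [hτmΔ]; ring) fm1 fm2 R R'
    hRint hcub hnorm hRR hprod (hprime τm)
  -- nonvanishing resolvent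
  obtain ⟨z, hz⟩ := hom_nonvanish hunr σ ρ hb.1 ι0 (two_ne_zero) ω
  have hz : R z ≠ 0 := hz
  have hz' := hRR z hz
  obtain ⟨a, b, hab⟩ := hplus z hz
  obtain ⟨a', b', hab'⟩ := hminus z hz
  obtain ⟨e, f, hef⟩ := hnorm z
  have hττ : τm (R z) ^ 3 = τp (R' z) ^ 3 := by
    obtain ⟨A, B, A', B', e1, e2⟩ := hcub z
    have e1' := congrArg τm e1
    have e2' := congrArg τp e2
    simp only [map_mul, map_add, map_sub, map_pow, map_intCast, map_ofNat] at e1' e2'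
    rw [hτms, hτmΔ] at e1'
    rw [hτps, hτpΔ] at e2'
    have h8 : (8 : Ω) ≠ 0 := by norm_num
    apply mul_left_cancel₀ h8
    rw [e1', e2']; ring
  have hefτ : τp (R z) * τp (R' z) = e - f * k s := by
    rw [← map_mul, hef]
    simp only [map_add, map_mul, map_ratCast]
    rw [hτps]; ring
  set H : Ω := e - f * k s with hH
  have hH0 : H ≠ 0 := by
    rw [← hefτ]
    exact mul_ne_zero ((map_ne_zero _).mpr hz) ((map_ne_zero _).mpr hz')
  set V : Ω := (a + b * Δ) * (a' + b' * r) with hV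
  have hUV : (R z ^ 2 * H) ^ 3 = V ^ 3 := by
    rw [hV, mul_pow, mul_pow, ← hab, ← hab', hττ, ← hefτ]; ring
  -- Galois action
  let g := AlgEquiv.liftNormal σ Ω
  have hg : ∀ x : L, g (ι x) = ι (σ x) := fun x => AlgEquiv.liftNormal_commutes σ Ω x
  have hgk : ∀ x : K, g (k x) = k x := fun x => g.commutes x
  have hggω : g (g ω) = ω := by
    have e0 := congrArg g hω
    simp only [map_add, map_pow, map_one, map_zero] at e0
    have : (g ω - ω) * (g ω - ω ^ 2) = 0 := by linear_combination e0 - (g ω) * hω + (ω - 1) * hω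
    rcases mul_eq_zero.mp this with h | h
    · have h : g ω = ω := by linear_combination h
      rw [h, h]
    · have h : g ω = ω ^ 2 := by linear_combination h
      rw [h, map_pow, h]
      linear_combination ω * hω3
  have hggΔ : g (g Δ) = Δ := by
    have e0 := congrArg g (congrArg g hΔμ)
    simp only [map_mul, map_add, map_one, map_ofNat] at e0
    rw [hgk, hgk, hg, hg, hσy, hσy, hggω, ← hΔμ] at e0
    exact mul_left_cancel₀ hkμ e0
  have hggr : g (g r) = r := by
    have e0 := congrArg g (congrArg g hr)
    simp only [map_mul, map_intCast] at e0
    rw [hgk, hgk, hggΔ, hr] at e0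
    exact (mul_left_cancel₀ hmΩ e0).symm
  have hggV : g (g V) = V := by
    rw [hV]; simp only [map_mul, map_add, map_ratCast]; rw [hggΔ, hggr]
  have hggH : g (g H) = H := by
    rw [hH]; simp only [map_mul, map_sub, map_ratCast]; rw [hgk, hgk]
  have hggR : g (g (R z)) = ω * R z := by
    have e0 : g (g (R z)) = ι (x3 z) + ω * ι (x1 z) + ω ^ 2 * ι (x2 z) := by
      change g (g (ι (x1 z) + ω * ι (x2 z) + ω ^ 2 * ι (x3 z))) = _
      simp only [map_add, map_mul, map_pow]
      simp only [hg, hggω, h1, h2, h3]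
    rw [e0]
    change _ = ω * (ι (x1 z) + ω * ι (x2 z) + ω ^ 2 * ι (x3 z))
    linear_combination (-ι (x3 z)) * hω3
  have hU0 : R z ^ 2 * H ≠ 0 := mul_ne_zero (pow_ne_zero 2 hz) hH0
  have hggU : g (g (R z ^ 2 * H)) = ω ^ 2 * (R z ^ 2 * H) := by
    simp only [map_mul, map_pow]
    rw [hggR, hggH]; ring
  have hfac : (R z ^ 2 * H - V) * ((R z ^ 2 * H - ω * V) * (R z ^ 2 * H - ω ^ 2 * V)) = 0 := by
    generalize R z ^ 2 * H = U at hUV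
    linear_combination hUV + (-U ^ 2 * V + U * V ^ 2 * ω) * hω + (-V ^ 3) * hω3
  have hfin : ∀ c : Ω, g (g c) = c → R z ^ 2 * H = c * V → False := by
    intro c hc hcV
    have h7 : g (g (R z ^ 2 * H)) = R z ^ 2 * H := by
      rw [hcV, map_mul, map_mul, hc, hggV]
    rw [hggU] at h7
    exact hω1 (mul_right_cancel₀ hU0 (by rw [h7, one_mul]))
  rcases mul_eq_zero.mp hfac with h | h
  · exact hfin 1 (by simp) (by linear_combination h)
  rcases mul_eq_zero.mp h with h | h
  · exact hfin ω hggω (by linear_combination h)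
  · exact hfin (ω ^ 2) (by rw [map_pow, map_pow, hggω]) (by linear_combination h)

/-- Let `K = ℚ(√-d)` be one of the nine imaginary quadratic fields of class number one, with
ring of integers `O_K`, and let `ε` be a generator of the unit group `O_Kˣ`.  There is no
Galois extension `L/K` with Galois group isomorphic to `S₃ ≅ GL₂(𝔽₂)` which is unramified at
every prime of `O_K` not dividing `2` and contains a square root of `ε`. -/
theorem no_S3_extension_unramified_outside_two_with_sqrt_unit
    (d : ℕ) (hd : d ∈ ({1, 2, 3, 7, 11, 19, 43, 67, 163} : Finset ℕ))
    (K : Type) [Field K] [NumberField K]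
    (s : K) (hs : s ^ 2 = -(d : K)) (hK : Module.finrank ℚ K = 2)
    (ε : (𝓞 K)ˣ) (hε : ∀ t : (𝓞 K)ˣ, t ∈ Subgroup.zpowers ε)
    (L : Type) [Field L] [Algebra K L] [NumberField L] [IsGalois K L]
    (hGal : Nonempty ((L ≃ₐ[K] L) ≃* Equiv.Perm (Fin 3)))
    (hunr : ∀ P : Ideal (𝓞 K), P.IsPrime → P ≠ ⊥ → (2 : 𝓞 K) ∉ P →
      ∀ Q : Ideal (𝓞 L), Q.IsPrime → Q.comap (algebraMap (𝓞 K) (𝓞 L)) = P →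
        Ideal.ramificationIdx' P Q = 1)
    (hsqrt : ∃ y : L, y ^ 2 = algebraMap K L ((ε : 𝓞 K) : K)) :
    False := by
  obtain ⟨e⟩ := hGal
  obtain ⟨σ, ρ, hσ3, hρ2, hρσ, hb⟩ := S3_gens e
  obtain ⟨y, hy⟩ := hsqrt
  obtain ⟨hnsq, δ, μ, hμ0, hμ, hδ⟩ := unit_facts d hd K s hs hK ε hε
  obtain ⟨hσy, hρy⟩ := y_action σ ρ hσ3 hb.2 _ hnsq y hy
  have hc : CharZero (AlgebraicClosure L) :=
    charZero_of_injective_algebraMap (algebraMap L (AlgebraicClosure L)).injective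
  have i1 : Algebra.IsAlgebraic K (AlgebraicClosure L) := Algebra.IsAlgebraic.trans K L _
  have i2 : Algebra.IsAlgebraic ℚ (AlgebraicClosure L) := Algebra.IsAlgebraic.trans ℚ L _
  have n1 : Normal K (AlgebraicClosure L) := normal_iff.mpr fun x =>
    ⟨Algebra.IsIntegral.isIntegral x, IsAlgClosed.splits _⟩
  have n2 : Normal ℚ (AlgebraicClosure L) := normal_iff.mpr fun x =>
    ⟨Algebra.IsIntegral.isIntegral x, IsAlgClosed.splits _⟩
  exact main_contra (Ω := AlgebraicClosure L) d hd s hs hK ε hunr σ ρ hσ3 hρ2 hρσ hb y hy hσy hρy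
    δ μ hμ0 hμ hδ
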